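/- arXiv:1305.3268 — 6 statements merged into one kernel-verified Lean document; each statement's English description precedes it below -/
import Mathlib

section
/- Let r be a positive integer, X a nonzero r×r real positive semidefinite matrix, λ₁ = ‖X‖ its operator norm, and W the λ₁-eigenspace of X (i.e., W = {w ∈ ℝ^r : Xw = λ₁w}). Then for every symmetric matrix Z ∈ ℝ^{r×r}, the right-sided derivative at ε = 0 of the function ε ↦ ‖X + εZ‖ exists and equals max{wᵀZw : w ∈ W, ‖w‖ = 1}; that is, lim_{ε→0⁺} (‖X + εZ‖ − λ₁)/ε = max_{w∈W, ‖w‖=1} wᵀZw. -/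
open Matrix Filter Topology

/-- Operator norm (ℓ² → ℓ²) of a square real matrix. -/
noncomputable def opNorm {r : ℕ} (M : Matrix (Fin r) (Fin r) ℝ) : ℝ :=
  ‖LinearMap.toContinuousLinearMap (Matrix.toEuclideanLin M)‖

/-- Euclidean norm of a vector. -/
noncomputable def evNorm {r : ℕ} (v : Fin r → ℝ) : ℝ := Real.sqrt (∑ i, v i ^ 2)

section Perturbation

variable {E : Type*} [NormedAddCommGroup E] [InnerProductSpace ℝ E]

theorem ContinuousLinearMap.abs_inner_apply_self_le (T : E →L[ℝ] E) {x : E} (hx : ‖x‖ = 1) :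
    |inner ℝ (T x) x| ≤ ‖T‖ := by
  have h := abs_real_inner_le_norm (T x) x
  have h' := T.le_opNorm x
  rw [hx, mul_one] at h h'
  exact h.trans h'

/-- A unit vector at which the quadratic form of `T` equals `‖T‖` is an eigenvector. -/
theorem ContinuousLinearMap.apply_eq_norm_smul_of_inner_eq_norm (T : E →L[ℝ] E) {x : E}
    (hx : ‖x‖ = 1) (h : inner ℝ (T x) x = ‖T‖) : T x = ‖T‖ • x := by
  have hle := T.le_opNorm x
  rw [hx, mul_one] at hle
  have key := norm_sub_sq_real (T x) (‖T‖ • x)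
  rw [inner_smul_right, h, norm_smul, norm_norm, hx] at key
  have hsq : ‖T x - ‖T‖ • x‖ ^ 2 ≤ 0 := by
    nlinarith [norm_nonneg (T x), norm_nonneg T]
  exact sub_eq_zero.1 (norm_eq_zero.1 (pow_eq_zero_iff two_ne_zero |>.1
    (le_antisymm hsq (sq_nonneg _))))

variable [FiniteDimensional ℝ E]

theorem ContinuousLinearMap.exists_unit_abs_inner_eq_norm [Nontrivial E] (T : E →L[ℝ] E)
    (hT : (T : E →ₗ[ℝ] E).IsSymmetric) :
    ∃ x : E, ‖x‖ = 1 ∧ |inner ℝ (T x) x| = ‖T‖ := by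
  obtain ⟨x, hx, hmax⟩ := (isCompact_sphere (0 : E) 1).exists_isMaxOn
    (NormedSpace.sphere_nonempty.2 zero_le_one)
    (f := fun x => |inner ℝ (T x) x|) (by fun_prop)
  rw [mem_sphere_zero_iff_norm] at hx
  refine ⟨x, hx, le_antisymm (T.abs_inner_apply_self_le hx) ?_⟩
  rw [T.norm_eq_iSup_rayleighQuotient hT]
  refine ciSup_le fun y => ?_
  rcases eq_or_ne y 0 with rfl | hy
  · simp
  · have hy' : ‖y‖ ≠ 0 := norm_ne_zero_iff.2 hy
    have hmem : ‖y‖⁻¹ • y ∈ Metric.sphere (0 : E) 1 := by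
      simp [norm_smul, hy']
    have hle : |inner ℝ (T (‖y‖⁻¹ • y)) (‖y‖⁻¹ • y)| ≤ |inner ℝ (T x) x| := hmax hmem
    refine le_trans (le_of_eq (congrArg _ ?_)) hle
    rw [map_smul, real_inner_smul_left, real_inner_smul_right]
    change inner ℝ (T y) y / ‖y‖ ^ 2 = _
    field_simp

theorem ContinuousLinearMap.exists_unit_inner_eq_norm_of_nonneg [Nontrivial E] (T : E →L[ℝ] E)
    (hT : (T : E →ₗ[ℝ] E).IsSymmetric) (hpos : ∀ x, 0 ≤ inner ℝ (T x) x) :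
    ∃ x : E, ‖x‖ = 1 ∧ inner ℝ (T x) x = ‖T‖ := by
  obtain ⟨x, hx, h⟩ := T.exists_unit_abs_inner_eq_norm hT
  exact ⟨x, hx, by rwa [abs_of_nonneg (hpos x)] at h⟩

/-- Away from the top eigenspace, in the sense that the quadratic form of `B` exceeds its maximum
there by `δ`, the quadratic form of `A` is bounded away from `‖A‖`. -/
theorem exists_lt_norm_forall_inner_le (A B : E →L[ℝ] E) {L δ : ℝ} (hδ : 0 < δ)
    (hL : ∀ w, A w = ‖A‖ • w → ‖w‖ = 1 → inner ℝ (B w) w ≤ L) :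
    ∃ μ < ‖A‖, ∀ x, ‖x‖ = 1 → L + δ ≤ inner ℝ (B x) x → inner ℝ (A x) x ≤ μ := by
  have hK : IsCompact (Metric.sphere (0 : E) 1 ∩ {x | L + δ ≤ inner ℝ (B x) x}) :=
    (isCompact_sphere 0 1).inter_right (isClosed_le (by fun_prop) (by fun_prop))
  rcases (Metric.sphere (0 : E) 1 ∩ {x | L + δ ≤ inner ℝ (B x) x}).eq_empty_or_nonempty with
    hemp | hne
  · refine ⟨‖A‖ - 1, by linarith, fun x hx hxB => ?_⟩
    have : x ∈ Metric.sphere (0 : E) 1 ∩ {x | L + δ ≤ inner ℝ (B x) x} :=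
      ⟨mem_sphere_zero_iff_norm.2 hx, hxB⟩
    simp [hemp] at this
  · obtain ⟨x, ⟨hx, hxB⟩, hmax⟩ := hK.exists_isMaxOn hne
      (f := fun x => inner ℝ (A x) x) (by fun_prop)
    rw [mem_sphere_zero_iff_norm] at hx
    refine ⟨inner ℝ (A x) x, ?_, fun y hy hyB => hmax ⟨mem_sphere_zero_iff_norm.2 hy, hyB⟩⟩
    refine lt_of_le_of_ne ((le_abs_self _).trans (A.abs_inner_apply_self_le hx)) fun heq => ?_
    have := hL x (A.apply_eq_norm_smul_of_inner_eq_norm hx heq) hx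
    simp only [Set.mem_ofPred_eq] at hxB
    linarith

/-- The right derivative at `0` of `ε ↦ ‖A + ε B‖` for `A` nonzero positive and `B` symmetric. -/
theorem ContinuousLinearMap.tendsto_norm_add_smul_sub_div {A B : E →L[ℝ] E} (hA0 : A ≠ 0)
    (hA : (A : E →ₗ[ℝ] E).IsSymmetric) (hpos : ∀ x, 0 ≤ inner ℝ (A x) x)
    (hB : (B : E →ₗ[ℝ] E).IsSymmetric) {w : E} (hw : A w = ‖A‖ • w) (hw1 : ‖w‖ = 1)
    (hL : ∀ v, A v = ‖A‖ • v → ‖v‖ = 1 → inner ℝ (B v) v ≤ inner ℝ (B w) w) :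
    Tendsto (fun ε : ℝ => (‖A + ε • B‖ - ‖A‖) / ε) (𝓝[>] 0) (𝓝 (inner ℝ (B w) w)) := by
  have hnt : Nontrivial E := ⟨w, 0, by rintro rfl; simp at hw1⟩
  have hform (ε : ℝ) (x : E) :
      inner ℝ ((A + ε • B) x) x = inner ℝ (A x) x + ε * inner ℝ (B x) x := by
    simp [inner_add_left, inner_smul_left]
  have hAw : inner ℝ (A w) w = ‖A‖ := by
    rw [hw, inner_smul_left, real_inner_self_eq_norm_sq, hw1]; simp
  have hlow {ε : ℝ} : ‖A‖ + ε * inner ℝ (B w) w ≤ ‖A + ε • B‖ := by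
    rw [← hAw, ← hform]
    exact (le_abs_self _).trans ((A + ε • B).abs_inner_apply_self_le hw1)
  rw [tendsto_order]
  refine ⟨fun a ha => ?_, fun b hb => ?_⟩
  · filter_upwards [self_mem_nhdsWithin] with ε hε
    refine ha.trans_le ((le_div_iff₀ hε).2 ?_)
    linarith [hlow (ε := ε)]
  · obtain ⟨μ, hμ, hgap⟩ := exists_lt_norm_forall_inner_le A B (sub_pos.2 hb) hL
    rw [add_sub_cancel] at hgap
    have hsmall {c : ℝ} (hc : 0 < c) : ∀ᶠ ε : ℝ in 𝓝[>] 0, 2 * ε * ‖B‖ < c := by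
      refine nhdsWithin_le_nhds (ContinuousAt.eventually_lt (by fun_prop) (by fun_prop) ?_)
      simpa using hc
    filter_upwards [self_mem_nhdsWithin, hsmall (norm_pos_iff.2 hA0),
      hsmall (sub_pos.2 hμ)] with ε hε h1 h2
    have hε' : 0 < ε := hε
    obtain ⟨x, hx, hxn⟩ := (A + ε • B).exists_unit_abs_inner_eq_norm (by
      intro u v
      have h1 := hA u v
      have h2 := hB u v
      simp only [ContinuousLinearMap.coe_coe] at h1 h2
      simp [inner_add_left, inner_add_right, inner_smul_left, inner_smul_right, h1, h2])
    rw [hform] at hxn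
    have hBx := abs_le.1 (B.abs_inner_apply_self_le hx)
    have hBw := abs_le.1 (B.abs_inner_apply_self_le hw1)
    have hAx := (le_abs_self _).trans (A.abs_inner_apply_self_le hx)
    have e1 := mul_le_mul_of_nonneg_left hBx.1 hε'.le
    have e2 := mul_le_mul_of_nonneg_left hBx.2 hε'.le
    have e3 := mul_le_mul_of_nonneg_left hBw.1 hε'.le
    have hl := hlow (ε := ε)
    have hx0 := hpos x
    have hval : inner ℝ (A x) x + ε * inner ℝ (B x) x = ‖A + ε • B‖ := by
      rcases abs_choice (inner ℝ (A x) x + ε * inner ℝ (B x) x) with h | h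
      · rw [← hxn, h]
      · exfalso; rw [hxn] at h; linarith
    have hlt : inner ℝ (B x) x < b := by
      by_contra! hge
      have := hgap x hx hge
      linarith
    rw [div_lt_iff₀ hε']
    have := mul_lt_mul_of_pos_left hlt hε'
    linarith

/-- The quadratic form of `B` attains its maximum on the unit sphere of the top eigenspace of a
positive operator `A`. -/
theorem ContinuousLinearMap.exists_isMax_inner_on_eigenspace_norm [Nontrivial E]
    {A : E →L[ℝ] E} (B : E →L[ℝ] E)
    (hA : (A : E →ₗ[ℝ] E).IsSymmetric) (hpos : ∀ x, 0 ≤ inner ℝ (A x) x) :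
    ∃ w, A w = ‖A‖ • w ∧ ‖w‖ = 1 ∧
      ∀ v, A v = ‖A‖ • v → ‖v‖ = 1 → inner ℝ (B v) v ≤ inner ℝ (B w) w := by
  have hK : IsCompact (Metric.sphere (0 : E) 1 ∩ {x | A x = ‖A‖ • x}) :=
    (isCompact_sphere 0 1).inter_right (isClosed_eq (by fun_prop) (by fun_prop))
  obtain ⟨x, hx, hxA⟩ := A.exists_unit_inner_eq_norm_of_nonneg hA hpos
  obtain ⟨w, ⟨hw1, hw⟩, hmax⟩ := hK.exists_isMaxOn
    ⟨x, mem_sphere_zero_iff_norm.2 hx, A.apply_eq_norm_smul_of_inner_eq_norm hx hxA⟩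
    (f := fun x => inner ℝ (B x) x) (by fun_prop)
  exact ⟨w, hw, mem_sphere_zero_iff_norm.1 hw1,
    fun v hv hv1 => hmax ⟨mem_sphere_zero_iff_norm.2 hv1, hv⟩⟩

end Perturbation

theorem evNorm_eq_norm_toLp {r : ℕ} (v : Fin r → ℝ) : evNorm v = ‖WithLp.toLp 2 v‖ := by
  simp [evNorm, EuclideanSpace.norm_eq]

theorem Matrix.inner_toEuclideanLin_toLp {r : ℕ} (M : Matrix (Fin r) (Fin r) ℝ) (v : Fin r → ℝ) :
    inner ℝ (Matrix.toEuclideanLin M (WithLp.toLp 2 v)) (WithLp.toLp 2 v) =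
      v ⬝ᵥ M.mulVec v := by
  simp [EuclideanSpace.inner_eq_star_dotProduct]

/-- Lemma 2.4 (derivative of the operator norm under linear perturbations):
for a nonzero PSD matrix `X` with operator norm `λ₁` and `λ₁`-eigenspace `W`,
and any symmetric `Z`, the right-sided derivative at `ε = 0` of
`ε ↦ ‖X + εZ‖` exists and equals `max {wᵀZw : w ∈ W, ‖w‖ = 1}`. -/
theorem opNorm_linear_perturbation_rightDeriv {r : ℕ} (hr : 0 < r)
    (X : Matrix (Fin r) (Fin r) ℝ) (hX : X.PosSemidef) (hX0 : X ≠ 0)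
    (Z : Matrix (Fin r) (Fin r) ℝ) (hZ : Z.IsSymm) :
    ∃ L : ℝ,
      IsGreatest {y : ℝ | ∃ w : Fin r → ℝ,
          X.mulVec w = opNorm X • w ∧ evNorm w = 1 ∧ y = w ⬝ᵥ Z.mulVec w} L ∧
      Tendsto (fun ε : ℝ => (opNorm (X + ε • Z) - opNorm X) / ε)
        (nhdsWithin 0 (Set.Ioi 0)) (nhds L) := by
  have hXpos := Matrix.isPositive_toEuclideanLin_iff.2 hX
  have hZsymm := Matrix.isSymmetric_toEuclideanLin_iff.2
    (show Z.IsHermitian by rwa [Matrix.IsHermitian, Matrix.conjTranspose_eq_transpose_of_trivial])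
  set A := LinearMap.toContinuousLinearMap (Matrix.toEuclideanLin X) with hA
  set B := LinearMap.toContinuousLinearMap (Matrix.toEuclideanLin Z) with hB
  have hAX : opNorm X = ‖A‖ := rfl
  have hA0 : A ≠ 0 := by simpa [hA] using hX0
  have hnt : Nontrivial (EuclideanSpace ℝ (Fin r)) := by
    have : Nonempty (Fin r) := ⟨⟨0, hr⟩⟩
    infer_instance
  have hAsymm : (A : EuclideanSpace ℝ (Fin r) →ₗ[ℝ] _).IsSymmetric := hXpos.isSymmetric
  have hpos : ∀ x, 0 ≤ inner ℝ (A x) x := hXpos.2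
  have heig (v : Fin r → ℝ) :
      A (WithLp.toLp 2 v) = ‖A‖ • WithLp.toLp 2 v ↔ X.mulVec v = opNorm X • v := by
    rw [hAX, ← WithLp.toLp_smul]
    exact (WithLp.toLp_injective 2).eq_iff
  obtain ⟨w, hw, hw1, hmax⟩ :=
    ContinuousLinearMap.exists_isMax_inner_on_eigenspace_norm B hAsymm hpos
  refine ⟨inner ℝ (B w) w, ⟨⟨w.ofLp, (heig _).1 hw, ?_, ?_⟩, ?_⟩, ?_⟩
  · rw [evNorm_eq_norm_toLp]; exact hw1
  · exact Z.inner_toEuclideanLin_toLp w.ofLp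
  · rintro _ ⟨v, hv, hv1, rfl⟩
    rw [← Z.inner_toEuclideanLin_toLp v]
    exact hmax _ ((heig v).2 hv) (by rwa [← evNorm_eq_norm_toLp])
  · have hnorm (ε : ℝ) : opNorm (X + ε • Z) = ‖A + ε • B‖ := by
      simp [opNorm, hA, hB]
    simp only [hnorm, hAX]
    exact ContinuousLinearMap.tendsto_norm_add_smul_sub_div hA0 hAsymm hpos hZsymm hw hw1 hmax
end

section
/- Let Δ > 0 be a real number, let I, J be finite sets, and let M ∈ [0,Δ]^{I×J} be a nonnegative matrix with a rank-r semidefinite factorization (U_i)_{i∈I}, (V^j)_{j∈J}, i.e., M_{ij} = Tr(U_i V^j) for all i ∈ I, j ∈ J. Then there exist r×r PSD matrices A and B with B a Moore–Penrose pseudo-inverse of A (i.e., ABA = A, BAB = B, and AB and BA are symmetric) such that (A U_i A)_{i∈I}, (B V^j B)_{j∈J} is again a rank-r semidefinite factorization of M (Tr((A U_i A)(B V^j B)) = M_{ij} for all i, j) and such that max_{i∈I} ‖A U_i A‖ ≤ √(rΔ) and max_{j∈J} ‖B V^j B‖ ≤ √(rΔ). -/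
open Matrix Filter Topology

open scoped MatrixOrder

namespace Matrix

section

variable {n : Type*} [Fintype n]

lemma PosSemidef.exists_conjTranspose_mul_self {A : Matrix n n ℝ} (hA : A.PosSemidef) :
    ∃ B : Matrix n n ℝ, A = Bᴴ * B := by
  classical
  exact CStarAlgebra.nonneg_iff_eq_star_mul_self.mp hA.nonneg

lemma PosSemidef.sq_apply_le {A : Matrix n n ℝ} (hA : A.PosSemidef) (i j : n) :
    A i j ^ 2 ≤ A i i * A j j := by
  obtain ⟨B, rfl⟩ := hA.exists_conjTranspose_mul_self
  simpa [Matrix.mul_apply, ← sq] using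
    Finset.sum_mul_sq_le_sq_mul_sq Finset.univ (fun k => B k i) (fun k => B k j)

lemma PosSemidef.sum_sq_apply_le_trace_sq {A : Matrix n n ℝ} (hA : A.PosSemidef) :
    ∑ i, ∑ j, A i j ^ 2 ≤ A.trace ^ 2 := by
  rw [sq A.trace, Matrix.trace, Finset.sum_mul_sum]
  exact Finset.sum_le_sum fun i _ => Finset.sum_le_sum fun j _ => hA.sq_apply_le i j

lemma PosSemidef.abs_apply_le_trace {A : Matrix n n ℝ} (hA : A.PosSemidef) (i j : n) :
    |A i j| ≤ A.trace := by
  refine abs_le_of_sq_le_sq ?_ hA.trace_nonneg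
  refine le_trans ?_ hA.sum_sq_apply_le_trace_sq
  refine le_trans ?_ (Finset.single_le_sum (f := fun i => ∑ j, A i j ^ 2)
    (fun i _ => Finset.sum_nonneg fun j _ => sq_nonneg _) (Finset.mem_univ i))
  exact Finset.single_le_sum (f := fun j => A i j ^ 2) (fun j _ => sq_nonneg _)
    (Finset.mem_univ j)

lemma PosSemidef.trace_mul_nonneg {A B : Matrix n n ℝ} (hA : A.PosSemidef) (hB : B.PosSemidef) :
    0 ≤ (A * B).trace := by
  obtain ⟨C, rfl⟩ := hA.exists_conjTranspose_mul_self
  rw [Matrix.mul_assoc, Matrix.trace_mul_comm]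
  exact (hB.mul_mul_conjTranspose_same C).trace_nonneg

/-- If `tr (A P) = 0` for a Hermitian idempotent `P` and a positive semidefinite `A`, then `P`
projects to the kernel of `A`. -/
lemma PosSemidef.mul_eq_zero_of_trace_eq_zero {A P : Matrix n n ℝ} (hA : A.PosSemidef)
    (hP : P.IsHermitian) (hPP : P * P = P) (h : (A * P).trace = 0) : A * P = 0 := by
  obtain ⟨C, rfl⟩ := hA.exists_conjTranspose_mul_self
  have : C * P = 0 := by
    rw [← trace_conjTranspose_mul_self_eq_zero_iff, conjTranspose_mul, hP.eq,
      Matrix.mul_assoc, Matrix.trace_mul_comm, ← h]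
    simp only [Matrix.mul_assoc, hPP]
  rw [Matrix.mul_assoc, this, Matrix.mul_zero]

lemma isClosed_setOf_posSemidef : IsClosed {A : Matrix n n ℝ | A.PosSemidef} := by
  simp only [posSemidef_iff_dotProduct_mulVec, Set.ofPred_and, Set.ofPred_forall,
    Matrix.IsHermitian]
  refine (isClosed_eq (by fun_prop) continuous_id).inter (isClosed_iInter fun x => ?_)
  exact isClosed_le continuous_const (by fun_prop)

lemma isCompact_setOf_posSemidef_trace_le (C : ℝ) :
    IsCompact {A : Matrix n n ℝ | A.PosSemidef ∧ A.trace ≤ C} := by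
  have hK : IsCompact (Set.univ.pi fun _ : n => Set.univ.pi fun _ : n => Set.Icc (-C) C) :=
    isCompact_univ_pi fun _ => isCompact_univ_pi fun _ => isCompact_Icc
  refine hK.of_isClosed_subset (isClosed_setOf_posSemidef.inter
    (isClosed_le (f := fun A : Matrix n n ℝ => A.trace) (by fun_prop) continuous_const))
    fun A hA => ?_
  simp only [Set.mem_pi, Set.mem_univ, true_implies]
  exact fun i j => abs_le.mp ((hA.1.abs_apply_le_trace i j).trans hA.2)

variable [DecidableEq n]

/-- The positive semidefinite matrices on which the functional `tr (· T)` is bounded by `C` form a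
compact set if `T` is positive definite. -/
lemma PosDef.isCompact_setOf_trace_mul_le {T : Matrix n n ℝ} (hT : T.PosDef) (C : ℝ) :
    IsCompact {A : Matrix n n ℝ | A.PosSemidef ∧ (A * T).trace ≤ C} := by
  obtain ⟨B, hB⟩ := hT.posSemidef.exists_conjTranspose_mul_self
  have hdet : IsUnit B.det := by
    have h := (Matrix.isUnit_iff_isUnit_det T).mp hT.isUnit
    rw [hB, det_mul] at h
    exact isUnit_of_mul_isUnit_right h
  refine ((isCompact_setOf_posSemidef_trace_le (n := n) C).image
    (f := fun X => B⁻¹ * X * (B⁻¹)ᴴ) (by fun_prop)).of_isClosed_subset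
    (isClosed_setOf_posSemidef.inter (isClosed_le (f := fun A => (A * T).trace) (by fun_prop)
      continuous_const)) ?_
  rintro A ⟨hA, hAT⟩
  refine ⟨B * A * Bᴴ, ⟨hA.mul_mul_conjTranspose_same B, ?_⟩, ?_⟩
  · rwa [Matrix.mul_assoc, Matrix.trace_mul_comm, Matrix.mul_assoc, ← hB]
  · have hB' : Bᴴ * (B⁻¹)ᴴ = 1 := by
      rw [← conjTranspose_mul, nonsing_inv_mul _ hdet, conjTranspose_one]
    calc B⁻¹ * (B * A * Bᴴ) * (B⁻¹)ᴴ = (B⁻¹ * B) * A * (Bᴴ * (B⁻¹)ᴴ) := by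
          simp only [Matrix.mul_assoc]
      _ = A := by rw [hB', nonsing_inv_mul _ hdet, Matrix.one_mul, Matrix.mul_one]

/-- First-order optimality condition for the determinant. -/
lemma trace_inv_mul_le_card_of_det_le {Y Z : Matrix n n ℝ} (hY : 0 < Y.det)
    (h : ∀ t ∈ Set.Ioc (0 : ℝ) 1, (Y + t • (Z - Y)).det ≤ Y.det) :
    (Y⁻¹ * Z).trace ≤ Fintype.card n := by
  have hu : IsUnit Y.det := hY.ne'.isUnit
  set W := Y⁻¹ * (Z - Y) with hW
  have htr : W.trace = (Y⁻¹ * Z).trace - Fintype.card n := by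
    rw [hW, Matrix.mul_sub, nonsing_inv_mul _ hu, trace_sub, trace_one]
  set p := (det (1 + (Polynomial.X : Polynomial ℝ) • W.map Polynomial.C)).divX.divX
  have hle : ∀ t ∈ Set.Ioc (0 : ℝ) 1, W.trace + p.eval t * t ≤ 0 := by
    intro t ht
    have hfac : Y + t • (Z - Y) = Y * (1 + t • W) := by
      rw [hW, Matrix.mul_add, Matrix.mul_one, Matrix.mul_smul, ← Matrix.mul_assoc,
        mul_nonsing_inv _ hu, Matrix.one_mul]
    have h1 := h t ht
    rw [hfac, det_mul, mul_le_iff_le_one_right hY, det_one_add_smul] at h1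
    have h2 : (W.trace + p.eval t * t) * t ≤ 0 := by linarith
    exact nonpos_of_mul_nonpos_left h2 ht.1
  have hlim : Tendsto (fun t : ℝ => W.trace + p.eval t * t) (𝓝[>] 0) (𝓝 W.trace) := by
    have : Continuous fun t : ℝ => W.trace + p.eval t * t := by fun_prop
    simpa using (this.tendsto 0).mono_left nhdsWithin_le_nhds
  have := le_of_tendsto hlim (Filter.mem_of_superset (Ioc_mem_nhdsGT one_pos) hle)
  linarith

/-- The orthogonal projection to the kernel of a positive semidefinite matrix. -/
lemma PosSemidef.exists_kernel_projection {S : Matrix n n ℝ} (hS : S.PosSemidef) :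
    ∃ Q : Matrix n n ℝ, Q.IsHermitian ∧ Q * Q = Q ∧ S * Q = 0 ∧ (S + Q).PosDef := by
  have hc (f : ℝ → ℝ) : ContinuousOn f (spectrum ℝ S) :=
    (Matrix.finite_real_spectrum (A := S)).continuousOn f
  have hsa : IsSelfAdjoint S := hS.isHermitian
  set f : ℝ → ℝ := fun x => if x = 0 then 1 else 0 with hf
  have hQ : (cfc f S).IsHermitian := cfc_predicate f S
  have hQQ : cfc f S * cfc f S = cfc f S := by
    rw [← cfc_mul f f S (hc _) (hc _)]
    congr 1; ext x; simp [hf]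
  have hQpsd : (cfc f S).PosSemidef := by
    have := posSemidef_conjTranspose_mul_self (cfc f S)
    rwa [hQ.eq, hQQ] at this
  refine ⟨cfc f S, hQ, hQQ, ?_, ?_⟩
  · have : S * cfc f S = cfc (fun x => x * f x) S := by
      rw [cfc_mul (fun x => x) f S (hc _) (hc _), cfc_id' ℝ S]
    rw [this, ← cfc_zero ℝ S]
    congr 1; ext x; simp [hf]
  · rw [(hS.add hQpsd).posDef_iff_isUnit]
    have : S + cfc f S = cfc (fun x => x + f x) S := by
      rw [cfc_add S (fun x => x) f (hc _) (hc _), cfc_id' ℝ S]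
    rw [this, isUnit_cfc_iff _ S (hc _)]
    intro x _
    by_cases hx : x = 0 <;> simp [hf, hx]

end

end Matrix

lemma opNorm_le_trace {r : ℕ} {M : Matrix (Fin r) (Fin r) ℝ} (hM : M.PosSemidef) :
    opNorm M ≤ M.trace := by
  refine ContinuousLinearMap.opNorm_le_bound _ hM.trace_nonneg fun x => ?_
  refine abs_le_of_sq_le_sq' ?_ (mul_nonneg hM.trace_nonneg (norm_nonneg _)) |>.2
  rw [mul_pow, EuclideanSpace.real_norm_sq_eq, EuclideanSpace.real_norm_sq_eq]
  refine le_trans ?_ (mul_le_mul_of_nonneg_right hM.sum_sq_apply_le_trace_sq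
    (Finset.sum_nonneg fun _ _ => sq_nonneg _))
  rw [Finset.sum_mul]
  exact Finset.sum_le_sum fun i _ => Finset.sum_mul_sq_le_sq_mul_sq Finset.univ (M i) x

/-- The main step of the rescaling: a positive definite `Y` commuting with the projection `Q` onto
the common kernel of the `V j`, which maximises the determinant under `tr (Y V_j) ≤ Δ`. -/
lemma exists_posDef_trace_bounds {ι κ n : Type*} [Fintype κ] [Fintype n] [DecidableEq n] {Δ : ℝ}
    (hΔ : 0 < Δ) {U : ι → Matrix n n ℝ} {V : κ → Matrix n n ℝ}
    (hU : ∀ i, (U i).PosSemidef) (hV : ∀ j, (V j).PosSemidef)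
    (hUV : ∀ i j, (U i * V j).trace ≤ Δ) :
    ∃ Y Q : Matrix n n ℝ, Y.PosDef ∧ Q.IsHermitian ∧ Q * Q = Q ∧ Commute Y Q ∧
      (∀ j, V j * Q = 0) ∧ (∀ j, (Y * V j).trace ≤ Δ) ∧
      ∀ i, (Y⁻¹ * ((1 - Q) * U i * (1 - Q))).trace ≤ Fintype.card n := by
  obtain ⟨Q, hQ, hQQ, hSQ, hT⟩ :=
    (posSemidef_sum Finset.univ fun j _ => hV j).exists_kernel_projection
  have hQpsd : Q.PosSemidef := by
    have := posSemidef_conjTranspose_mul_self Q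
    rwa [hQ.eq, hQQ] at this
  have hVQ (j : κ) : V j * Q = 0 := by
    refine (hV j).mul_eq_zero_of_trace_eq_zero hQ hQQ ?_
    have h0 : ∑ j, (V j * Q).trace = 0 := by
      rw [← trace_sum, ← Finset.sum_mul, hSQ, trace_zero]
    exact (Finset.sum_eq_zero_iff_of_nonneg
      fun j _ => (hV j).trace_mul_nonneg hQpsd).mp h0 j (Finset.mem_univ j)
  have hQV (j : κ) : Q * V j = 0 := by
    have := congrArg conjTranspose (hVQ j)
    rwa [conjTranspose_mul, hQ.eq, (hV j).isHermitian.eq, conjTranspose_zero] at this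
  set K : Set (Matrix n n ℝ) :=
    {Y | Y.PosSemidef ∧ Y * Q = Q * Y ∧ (∀ j, (Y * V j).trace ≤ Δ) ∧ (Y * Q).trace ≤ 1} with hK
  have hKclosed : IsClosed K := by
    have hV' : IsClosed {Y : Matrix n n ℝ | ∀ j, (Y * V j).trace ≤ Δ} := by
      simp only [Set.ofPred_forall]
      exact isClosed_iInter fun j => isClosed_le (by fun_prop) continuous_const
    have hQ' : IsClosed {Y : Matrix n n ℝ | (Y * Q).trace ≤ 1} :=
      isClosed_le (by fun_prop) continuous_const
    exact isClosed_setOf_posSemidef.inter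
      ((isClosed_eq (by fun_prop) (by fun_prop)).inter (hV'.inter hQ'))
  have hKcompact : IsCompact K := by
    refine (hT.isCompact_setOf_trace_mul_le (Fintype.card κ * Δ + 1)).of_isClosed_subset
      hKclosed ?_
    rintro Y ⟨hY, -, hYV, hYQ⟩
    refine ⟨hY, ?_⟩
    rw [Matrix.mul_add, trace_add, Finset.mul_sum, trace_sum]
    refine add_le_add ?_ hYQ
    simpa using Finset.sum_le_card_nsmul Finset.univ _ Δ fun j _ => hYV j
  have hKconvex : ∀ Y ∈ K, ∀ Z ∈ K, ∀ t ∈ Set.Ioc (0 : ℝ) 1, Y + t • (Z - Y) ∈ K := by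
    rintro Y ⟨hY, hYc, hYV, hYQ⟩ Z ⟨hZ, hZc, hZV, hZQ⟩ t ⟨ht0, ht1⟩
    have hcomb : Y + t • (Z - Y) = (1 - t) • Y + t • Z := by module
    have hs : 0 ≤ 1 - t := by linarith
    rw [hcomb]
    refine ⟨(hY.smul hs).add (hZ.smul ht0.le), ?_, fun j => ?_, ?_⟩
    · simp only [Matrix.add_mul, Matrix.mul_add, Matrix.smul_mul, Matrix.mul_smul, hYc, hZc]
    · simp only [Matrix.add_mul, Matrix.smul_mul, trace_add, trace_smul, smul_eq_mul]
      nlinarith [hYV j, hZV j]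
    · simp only [Matrix.add_mul, Matrix.smul_mul, trace_add, trace_smul, smul_eq_mul]
      nlinarith
  obtain ⟨ε, hε, hεK⟩ : ∃ ε : ℝ, 0 < ε ∧ ε • (1 : Matrix n n ℝ) ∈ K := by
    set s := 1 + ∑ j, (V j).trace + Q.trace with hs
    have hVs (j : κ) : (V j).trace ≤ ∑ j, (V j).trace :=
      Finset.single_le_sum (f := fun j => (V j).trace) (fun j _ => (hV j).trace_nonneg)
        (Finset.mem_univ j)
    have hsum : 0 ≤ ∑ j, (V j).trace := Finset.sum_nonneg fun j _ => (hV j).trace_nonneg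
    have hQ0 := hQpsd.trace_nonneg
    have hs0 : 0 < s := by linarith
    have hm : 0 < min Δ 1 := lt_min hΔ one_pos
    have hbound {x : ℝ} (hx : x ≤ s) : min Δ 1 / s * x ≤ min Δ 1 := by
      rw [div_mul_eq_mul_div, div_le_iff₀ hs0]
      exact mul_le_mul_of_nonneg_left hx hm.le
    refine ⟨min Δ 1 / s, div_pos hm hs0, PosSemidef.one.smul (div_pos hm hs0).le, ?_,
      fun j => ?_, ?_⟩
    · simp
    · simpa using (hbound (x := (V j).trace) (by linarith [hVs j])).trans (min_le_left _ _)
    · simpa using (hbound (x := Q.trace) (by linarith)).trans (min_le_right _ _)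
  obtain ⟨Y, hYK, hmax⟩ := hKcompact.exists_isMaxOn ⟨_, hεK⟩
    (f := fun Y => Y.det) (by fun_prop)
  have hdet : 0 < Y.det := by
    refine lt_of_lt_of_le ?_ (hmax hεK)
    simp only [det_smul, det_one, mul_one]
    positivity
  obtain ⟨hY, hYc, hYV, hYQ⟩ := id hYK
  refine ⟨Y, Q, hY.posDef_iff_det_ne_zero.mpr hdet.ne', hQ, hQQ, hYc, hVQ, hYV, fun i => ?_⟩
  refine trace_inv_mul_le_card_of_det_le hdet fun t ht => hmax (hKconvex Y hYK _ ?_ t ht)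
  have hP : (1 - Q)ᴴ = 1 - Q := by rw [conjTranspose_sub, conjTranspose_one, hQ.eq]
  have hPQ : (1 - Q) * Q = 0 := by rw [Matrix.sub_mul, Matrix.one_mul, hQQ, sub_self]
  have hQP : Q * (1 - Q) = 0 := by rw [Matrix.mul_sub, Matrix.mul_one, hQQ, sub_self]
  refine ⟨?_, ?_, fun j => ?_, ?_⟩
  · have := (hU i).mul_mul_conjTranspose_same (1 - Q)
    rwa [hP] at this
  · rw [Matrix.mul_assoc _ (1 - Q) Q, hPQ, ← Matrix.mul_assoc, ← Matrix.mul_assoc, hQP]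
    simp
  · have hPV : (1 - Q) * V j = V j := by rw [Matrix.sub_mul, Matrix.one_mul, hQV, sub_zero]
    have hVP : V j * (1 - Q) = V j := by rw [Matrix.mul_sub, Matrix.mul_one, hVQ, sub_zero]
    rw [Matrix.mul_assoc, hPV, Matrix.mul_assoc, Matrix.trace_mul_comm, Matrix.mul_assoc, hVP]
    exact hUV i j
  · rw [Matrix.mul_assoc, hPQ]
    simp

/-- Theorem 3.1 (Rescaling semidefinite factorizations): if a nonnegative matrix
`M ∈ [0,Δ]^{I×J}` has a rank-`r` semidefinite factorization `(U_i), (V^j)`, then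
there are PSD matrices `A`, `B`, with `B` a Moore–Penrose pseudo-inverse of `A`,
such that `(A U_i A), (B V^j B)` is again a semidefinite factorization of `M`
and all its factors have operator norm at most `√(rΔ)`. -/
theorem rescale_sdp_factorization {ι κ : Type*} [Fintype ι] [Fintype κ]
    {r : ℕ} (Δ : ℝ) (hΔ : 0 < Δ) (M : ι → κ → ℝ)
    (hM : ∀ i j, M i j ∈ Set.Icc (0 : ℝ) Δ)
    (U : ι → Matrix (Fin r) (Fin r) ℝ) (V : κ → Matrix (Fin r) (Fin r) ℝ)
    (hU : ∀ i, (U i).PosSemidef) (hV : ∀ j, (V j).PosSemidef)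
    (hfact : ∀ i j, (U i * V j).trace = M i j) :
    ∃ A B : Matrix (Fin r) (Fin r) ℝ,
      A.PosSemidef ∧ B.PosSemidef ∧
      A * B * A = A ∧ B * A * B = B ∧ (A * B).IsSymm ∧ (B * A).IsSymm ∧
      (∀ i j, ((A * U i * A) * (B * V j * B)).trace = M i j) ∧
      (∀ i, opNorm (A * U i * A) ≤ Real.sqrt (r * Δ)) ∧
      (∀ j, opNorm (B * V j * B) ≤ Real.sqrt (r * Δ)) := by
  rcases Nat.eq_zero_or_pos r with rfl | hr
  · refine ⟨0, 0, .zero, .zero, ?_, ?_, ?_, ?_, fun i j => ?_, fun i => ?_, fun j => ?_⟩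
    · simp
    · simp
    · simp
    · simp
    · rw [← hfact]; simp [Matrix.trace]
    · simp [opNorm]
    · simp [opNorm]
  obtain ⟨Y, Q, hY, hQ, hQQ, hYQ, hVQ, hYV, hYU⟩ :=
    exists_posDef_trace_bounds hΔ hU hV fun i j => (hfact i j).trans_le (hM i j).2
  set P := 1 - Q with hPdef
  have hPh : P.IsHermitian := by
    rw [IsHermitian, hPdef, conjTranspose_sub, conjTranspose_one, hQ.eq]
  have hPP : P * P = P := by
    rw [hPdef, Matrix.sub_mul, Matrix.mul_sub, Matrix.mul_sub, hQQ]; simp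
  have hVP (j) : V j * P = V j := by rw [hPdef, Matrix.mul_sub, hVQ]; simp
  have hPV (j) : P * V j = V j := by
    have := congrArg conjTranspose (hVP j)
    rwa [conjTranspose_mul, hPh.eq, (hV j).isHermitian.eq] at this
  set H := CFC.sqrt Y with hH
  have hHpsd : H.PosSemidef := (CFC.sqrt_nonneg Y).posSemidef
  have hHH : H * H = Y := CFC.sqrt_mul_sqrt_self Y hY.posSemidef.nonneg
  have hHunit : IsUnit H.det := by
    have h := (Matrix.isUnit_iff_isUnit_det Y).mp hY.isUnit
    rw [← hHH, det_mul] at h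
    exact isUnit_of_mul_isUnit_right h
  have hHP : H * P = P * H := by
    rw [hH, CFC.sqrt_eq_cfc]
    exact ((Commute.one_right Y).sub_right hYQ).cfc_nnreal _
  set L := H⁻¹ with hL
  have hLpsd : L.PosSemidef := hHpsd.inv
  have hLH : L * H = 1 := nonsing_inv_mul _ hHunit
  have hHL : H * L = 1 := mul_nonsing_inv _ hHunit
  have hLL : L * L = Y⁻¹ := by rw [← hHH, Matrix.mul_inv_rev]
  have hLP : L * P = P * L := by
    calc L * P = L * (P * H) * L := by
          rw [Matrix.mul_assoc, Matrix.mul_assoc, hHL, Matrix.mul_one]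
      _ = P * L := by rw [← hHP, ← Matrix.mul_assoc, hLH, Matrix.one_mul]
  have hpsd {X : Matrix (Fin r) (Fin r) ℝ} (hX : X.PosSemidef) (hXP : X * P = P * X) :
      (P * X).PosSemidef := by
    have := hX.mul_mul_conjTranspose_same P
    rwa [hPh.eq, Matrix.mul_assoc, hXP, ← Matrix.mul_assoc, hPP] at this
  have hr' : (0 : ℝ) < r := by exact_mod_cast hr
  obtain ⟨c, hc, hc1, hc2⟩ : ∃ c : ℝ, 0 < c ∧ c * c * r = √(r * Δ) ∧
      c⁻¹ * c⁻¹ * Δ = √(r * Δ) := by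
    have hs : 0 < √(r * Δ) := Real.sqrt_pos.mpr (by positivity)
    have hss : √(r * Δ) * √(r * Δ) = r * Δ := Real.mul_self_sqrt (by positivity)
    have hcc : √(√(r * Δ) / r) * √(√(r * Δ) / r) = √(r * Δ) / r :=
      Real.mul_self_sqrt (by positivity)
    refine ⟨√(√(r * Δ) / r), Real.sqrt_pos.mpr (by positivity), ?_, ?_⟩
    · rw [hcc]; field_simp
    · rw [← mul_inv, hcc, inv_div, div_mul_eq_mul_div, div_eq_iff hs.ne', hss]
  have hA : (c • (P * L)).PosSemidef := (hpsd hLpsd hLP).smul hc.le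
  have hB : (c⁻¹ • (P * H)).PosSemidef := (hpsd hHpsd hHP).smul (inv_pos.mpr hc).le
  have hAB : (c • (P * L)) * (c⁻¹ • (P * H)) = P := by
    rw [Matrix.smul_mul, Matrix.mul_smul, smul_smul, mul_inv_cancel₀ hc.ne', one_smul, ← hLP,
      Matrix.mul_assoc, ← Matrix.mul_assoc P P, hPP, ← hHP, ← Matrix.mul_assoc, hLH,
      Matrix.one_mul]
  have hBA : (c⁻¹ • (P * H)) * (c • (P * L)) = P := by
    rw [Matrix.smul_mul, Matrix.mul_smul, smul_smul, inv_mul_cancel₀ hc.ne', one_smul, ← hHP,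
      Matrix.mul_assoc, ← Matrix.mul_assoc P P, hPP, ← hLP, ← Matrix.mul_assoc, hHL,
      Matrix.one_mul]
  have hPA : P * (c • (P * L)) = c • (P * L) := by
    rw [Matrix.mul_smul, ← Matrix.mul_assoc, hPP]
  have hPB : P * (c⁻¹ • (P * H)) = c⁻¹ • (P * H) := by
    rw [Matrix.mul_smul, ← Matrix.mul_assoc, hPP]
  have hPsymm : P.IsSymm := hPh
  have hAUA (i) : (c • (P * L)) * U i * (c • (P * L)) = (c * c) • (L * (P * U i * P) * L) := by
    simp only [Matrix.smul_mul, Matrix.mul_smul, smul_smul]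
    congr 1
    nth_rw 1 [← hLP]
    simp only [Matrix.mul_assoc]
  have hBVB (j) : (c⁻¹ • (P * H)) * V j * (c⁻¹ • (P * H)) = (c⁻¹ * c⁻¹) • (H * V j * H) := by
    simp only [Matrix.smul_mul, Matrix.mul_smul, smul_smul]
    congr 1
    nth_rw 1 [← hHP]
    rw [Matrix.mul_assoc H, hPV, ← Matrix.mul_assoc, Matrix.mul_assoc H, hVP]
  refine ⟨c • (P * L), c⁻¹ • (P * H), hA, hB, by rw [hAB, hPA], by rw [hBA, hPB],
    by rwa [hAB], by rwa [hBA], fun i j => ?_, fun i => ?_, fun j => ?_⟩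
  · generalize c • (P * L) = A at *
    generalize c⁻¹ • (P * H) = B at *
    calc (A * U i * A * (B * V j * B)).trace = (A * (U i * (A * B) * V j * B)).trace := by
          simp only [Matrix.mul_assoc]
      _ = (U i * P * V j * (B * A)).trace := by
          rw [hAB, Matrix.trace_mul_comm]; simp only [Matrix.mul_assoc]
      _ = M i j := by
          rw [hBA, Matrix.mul_assoc, hVP, Matrix.mul_assoc, hPV, hfact]
  · have hpos : ((c • (P * L)) * U i * (c • (P * L))).PosSemidef := by
      simpa only [hA.isHermitian.eq] using (hU i).mul_mul_conjTranspose_same (c • (P * L))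
    refine (opNorm_le_trace hpos).trans ?_
    rw [hAUA, trace_smul, Matrix.trace_mul_comm, ← Matrix.mul_assoc, hLL, smul_eq_mul, ← hc1]
    exact mul_le_mul_of_nonneg_left (by simpa using hYU i) (by positivity)
  · have hpos : ((c⁻¹ • (P * H)) * V j * (c⁻¹ • (P * H))).PosSemidef := by
      simpa only [hB.isHermitian.eq] using (hV j).mul_mul_conjTranspose_same (c⁻¹ • (P * H))
    refine (opNorm_le_trace hpos).trans ?_
    rw [hBVB, trace_smul, Matrix.trace_mul_comm, ← Matrix.mul_assoc, hHH, smul_eq_mul, ← hc2]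
    exact mul_le_mul_of_nonneg_left (hYV j) (by positivity)
end

section
/- Let M ∈ ℝ_{≥0}^{I×J} be a nonnegative matrix with a rank-r semidefinite factorization (U_i)_{i∈I}, (V^j)_{j∈J} such that Ū = (1/|I|) Σ_{i∈I} U_i and V̄ = (1/|J|) Σ_{j∈J} V^j are nonsingular. Let σ > 0 satisfy Ū ⪰ σI_r and V̄ ⪰ σI_r, and let τ = (max_{i∈I} ‖U_i‖) · (max_{j∈J} ‖V^j‖). If A is a nonsingular r×r PSD matrix satisfying (max_{i∈I} ‖A U_i A‖) · (max_{j∈J} ‖A⁻¹ V^j A⁻¹‖) ≤ τ, then there exists s > 0 such that I_r ⪯ sA ⪯ (τ/σ²) I_r. -/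
open Matrix Filter Topology

lemma dotProduct_mulVec_le_opNorm {r : ℕ} (M : Matrix (Fin r) (Fin r) ℝ)
    (x : EuclideanSpace ℝ (Fin r)) (hx : ‖x‖ = 1) :
    x.ofLp ⬝ᵥ (M *ᵥ x.ofLp) ≤ opNorm M := by
  rw [← inner_toEuclideanCLM]
  calc inner ℝ x (toEuclideanCLM (𝕜 := ℝ) M x)
      ≤ ‖x‖ * ‖toEuclideanCLM (𝕜 := ℝ) M x‖ := real_inner_le_norm _ _
    _ ≤ ‖x‖ * (‖toEuclideanCLM (𝕜 := ℝ) M‖ * ‖x‖) := by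
        gcongr
        exact ContinuousLinearMap.le_opNorm _ _
    _ = opNorm M := by
        rw [hx, one_mul, mul_one]
        rfl

/-- If the average of the `W i` dominates `σ • 1`, then every eigenvalue `l` of a Hermitian `B`
satisfies `σ * l ^ 2 ≤ ⨆ i, opNorm (B * W i * B)`. -/
lemma mul_sq_le_iSup_opNorm {ι : Type*} [Fintype ι] [Nonempty ι] {r : ℕ}
    (W : ι → Matrix (Fin r) (Fin r) ℝ) {σ : ℝ}
    (hW : ((Fintype.card ι : ℝ)⁻¹ • ∑ i, W i - σ • (1 : Matrix (Fin r) (Fin r) ℝ)).PosSemidef)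
    {B : Matrix (Fin r) (Fin r) ℝ} (hB : B.IsHermitian) {l : ℝ}
    (x : EuclideanSpace ℝ (Fin r)) (hx : ‖x‖ = 1) (hBx : B *ᵥ x.ofLp = l • x.ofLp) :
    σ * l ^ 2 ≤ ⨆ i, opNorm (B * W i * B) := by
  have hxx : x.ofLp ⬝ᵥ x.ofLp = 1 := by
    have h := real_inner_self_eq_norm_sq x
    rw [hx, EuclideanSpace.inner_eq_star_dotProduct] at h
    simpa using h
  have hxB : x.ofLp ᵥ* B = l • x.ofLp := by
    rw [← hBx, ← mulVec_transpose, ← conjTranspose_eq_transpose_of_trivial, hB.eq]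
  have hquad (i : ι) : l ^ 2 * (x.ofLp ⬝ᵥ (W i *ᵥ x.ofLp)) ≤ ⨆ i, opNorm (B * W i * B) := by
    calc l ^ 2 * (x.ofLp ⬝ᵥ (W i *ᵥ x.ofLp)) = x.ofLp ⬝ᵥ ((B * W i * B) *ᵥ x.ofLp) := by
          rw [← mulVec_mulVec, ← mulVec_mulVec, hBx, dotProduct_mulVec x.ofLp B, hxB, mulVec_smul,
            smul_dotProduct, dotProduct_smul, smul_eq_mul, smul_eq_mul]
          ring
      _ ≤ opNorm (B * W i * B) := dotProduct_mulVec_le_opNorm _ x hx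
      _ ≤ _ := le_ciSup (f := fun i => opNorm (B * W i * B)) (Set.finite_range _).bddAbove i
  have hcard : (0 : ℝ) < Fintype.card ι := by exact_mod_cast Fintype.card_pos
  have hσ : σ ≤ (Fintype.card ι : ℝ)⁻¹ * ∑ i, x.ofLp ⬝ᵥ (W i *ᵥ x.ofLp) := by
    have h := hW.dotProduct_mulVec_nonneg x.ofLp
    rw [star_trivial, sub_mulVec, dotProduct_sub, smul_mulVec, smul_mulVec, one_mulVec,
      dotProduct_smul, dotProduct_smul, hxx, sum_mulVec, dotProduct_sum] at h
    simpa using h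
  calc σ * l ^ 2 ≤ ((Fintype.card ι : ℝ)⁻¹ * ∑ i, x.ofLp ⬝ᵥ (W i *ᵥ x.ofLp)) * l ^ 2 := by gcongr
    _ = (Fintype.card ι : ℝ)⁻¹ * ∑ i, l ^ 2 * (x.ofLp ⬝ᵥ (W i *ᵥ x.ofLp)) := by
        rw [← Finset.mul_sum]
        ring
    _ ≤ (Fintype.card ι : ℝ)⁻¹ * ∑ _i : ι, ⨆ i, opNorm (B * W i * B) := by
        gcongr with i
        exact hquad i
    _ = _ := by
        rw [Finset.sum_const, Finset.card_univ, nsmul_eq_mul, inv_mul_cancel_left₀ hcard.ne']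

lemma Matrix.IsHermitian.posSemidef_smul_add_smul_one {n : Type*} [Fintype n] [DecidableEq n]
    {A : Matrix n n ℝ} (hA : A.IsHermitian) (p q : ℝ) (h : ∀ i, 0 ≤ p * hA.eigenvalues i + q) :
    (p • A + q • (1 : Matrix n n ℝ)).PosSemidef := by
  have key : p • A + q • (1 : Matrix n n ℝ) =
      (hA.eigenvectorUnitary : Matrix n n ℝ) * diagonal (fun i => p * hA.eigenvalues i + q) *
        (hA.eigenvectorUnitary : Matrix n n ℝ)ᴴ := by
    have hd : diagonal (fun i => p * hA.eigenvalues i + q) =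
        p • diagonal hA.eigenvalues + q • (1 : Matrix n n ℝ) := by
      ext i j
      by_cases hij : i = j <;> simp [hij]
    have hu : (hA.eigenvectorUnitary : Matrix n n ℝ) * (hA.eigenvectorUnitary : Matrix n n ℝ)ᴴ
        = 1 := Unitary.coe_mul_star_self _
    have hs : A = (hA.eigenvectorUnitary : Matrix n n ℝ) * diagonal hA.eigenvalues *
        (hA.eigenvectorUnitary : Matrix n n ℝ)ᴴ := hA.spectral_theorem
    rw [hd, mul_add, add_mul, mul_smul_comm, mul_smul_comm, smul_mul_assoc, smul_mul_assoc,
      mul_one, hu, ← hs]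
  rw [key]
  exact (PosSemidef.diagonal h).mul_mul_conjTranspose_same _

/-- Claim 3.3: if `(U_i), (V^j)` is a semidefinite factorization of a nonnegative
matrix `M` with nonsingular averages `Ū ⪰ σI`, `V̄ ⪰ σI` (`σ > 0`), and a
nonsingular PSD matrix `A` satisfies
`(max_i ‖A U_i A‖)·(max_j ‖A⁻¹ V^j A⁻¹‖) ≤ τ := (max_i ‖U_i‖)·(max_j ‖V^j‖)`,
then `I ⪯ sA ⪯ (τ/σ²) I` for some `s > 0`. -/
theorem rescaled_potential_bound
    {ι κ : Type*} [Fintype ι] [Nonempty ι] [Fintype κ] [Nonempty κ]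
    {r : ℕ} (M : ι → κ → ℝ) (hM : ∀ i j, 0 ≤ M i j)
    (U : ι → Matrix (Fin r) (Fin r) ℝ) (V : κ → Matrix (Fin r) (Fin r) ℝ)
    (hU : ∀ i, (U i).PosSemidef) (hV : ∀ j, (V j).PosSemidef)
    (hfact : ∀ i j, (U i * V j).trace = M i j)
    (Ubar Vbar : Matrix (Fin r) (Fin r) ℝ)
    (hUbar : Ubar = (Fintype.card ι : ℝ)⁻¹ • ∑ i, U i)
    (hVbar : Vbar = (Fintype.card κ : ℝ)⁻¹ • ∑ j, V j)
    (hUbarNS : IsUnit Ubar) (hVbarNS : IsUnit Vbar)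
    (σ : ℝ) (hσ : 0 < σ)
    (hUσ : (Ubar - σ • (1 : Matrix (Fin r) (Fin r) ℝ)).PosSemidef)
    (hVσ : (Vbar - σ • (1 : Matrix (Fin r) (Fin r) ℝ)).PosSemidef)
    (τ : ℝ) (hτ : τ = (⨆ i, opNorm (U i)) * (⨆ j, opNorm (V j)))
    (A : Matrix (Fin r) (Fin r) ℝ) (hA : A.PosSemidef) (hANS : IsUnit A)
    (hΦ : (⨆ i, opNorm (A * U i * A)) * (⨆ j, opNorm (A⁻¹ * V j * A⁻¹)) ≤ τ) :
    ∃ s : ℝ, 0 < s ∧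
      (s • A - 1).PosSemidef ∧ ((τ / σ ^ 2) • (1 : Matrix (Fin r) (Fin r) ℝ) - s • A).PosSemidef := by
  have hAh := hA.isHermitian
  obtain _ | _ := isEmpty_or_nonempty (Fin r)
  · refine ⟨1, one_pos, ?_, ?_⟩ <;>
      · rw [Subsingleton.elim (_ - _) (0 : Matrix (Fin r) (Fin r) ℝ)]
        exact .zero
  subst hUbar hVbar
  set l := hAh.eigenvalues
  have hpos (i : Fin r) : 0 < l i := (hA.posDef_iff_isUnit.mpr hANS).eigenvalues_pos i
  have hnorm (i : Fin r) : ‖hAh.eigenvectorBasis i‖ = 1 := hAh.eigenvectorBasis.norm_eq_one i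
  have heig (i : Fin r) := hAh.mulVec_eigenvectorBasis i
  have hinv (i : Fin r) : A⁻¹ *ᵥ (hAh.eigenvectorBasis i).ofLp =
      (l i)⁻¹ • (hAh.eigenvectorBasis i).ofLp := by
    rw [eq_inv_smul_iff₀ (hpos i).ne', ← mulVec_smul, ← heig, mulVec_mulVec,
      nonsing_inv_mul _ ((isUnit_iff_isUnit_det A).mp hANS), one_mulVec]
  have hP (i : Fin r) := mul_sq_le_iSup_opNorm U hUσ hAh _ (hnorm i) (heig i)
  have hQ (i : Fin r) := mul_sq_le_iSup_opNorm V hVσ hAh.inv _ (hnorm i) (hinv i)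
  obtain ⟨k, hk⟩ := Finite.exists_min l
  have hratio (i : Fin r) : (l i / l k) ^ 2 ≤ τ / σ ^ 2 := by
    rw [le_div_iff₀ (by positivity)]
    calc (l i / l k) ^ 2 * σ ^ 2 = (σ * l i ^ 2) * (σ * (l k)⁻¹ ^ 2) := by
          rw [div_eq_mul_inv]
          ring
      _ ≤ _ := mul_le_mul (hP i) (hQ k) (by positivity)
          (le_trans (by positivity) (hP i))
      _ ≤ τ := hΦ
  refine ⟨(l k)⁻¹, inv_pos.mpr (hpos k), ?_, ?_⟩
  · have h := hAh.posSemidef_smul_add_smul_one (l k)⁻¹ (-1) fun i => by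
      have : 1 ≤ (l k)⁻¹ * l i := by
        rw [← div_eq_inv_mul, one_le_div (hpos k)]
        exact hk i
      linarith
    rwa [neg_one_smul, ← sub_eq_add_neg] at h
  · have h := hAh.posSemidef_smul_add_smul_one (-(l k)⁻¹) (τ / σ ^ 2) fun i => by
      have h1 : 1 ≤ l i / l k := (one_le_div (hpos k)).mpr (hk i)
      have h2 : l i / l k ≤ τ / σ ^ 2 := (le_self_pow₀ h1 two_ne_zero).trans (hratio i)
      rw [div_eq_inv_mul] at h2
      linarith
    rwa [neg_smul, neg_add_eq_sub] at h
end

section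
/- Let U and V be r×r real positive semidefinite matrices, let μ, ν ≥ 0, and let z, v ∈ ℝ^r be unit vectors with Uz = μz and Vv = νv. Then μ·ν·(zᵀv)² ≤ Tr(UᵀV). In particular, if Tr(UᵀV) ≤ Δ and μ = ν, then (zᵀv)² ≤ Δ/μ² whenever μ > 0. -/
open Matrix Filter Topology

open scoped MatrixOrder in
/-- The trace inner product of two real positive semidefinite matrices is nonnegative. -/
theorem Matrix.PosSemidef.trace_mul_nonneg_s7 {n : Type*} [Fintype n] [DecidableEq n]
    {A B : Matrix n n ℝ} (hA : A.PosSemidef) (hB : B.PosSemidef) : 0 ≤ (A * B).trace := by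
  obtain ⟨C, rfl⟩ := CStarAlgebra.nonneg_iff_eq_star_mul_self.mp hB.nonneg
  rw [star_eq_conjTranspose]
  rw [← Matrix.mul_assoc, trace_mul_comm, ← Matrix.mul_assoc]
  exact (hA.mul_mul_conjTranspose_same C).trace_nonneg

/-- Subtracting the rank-one spectral part of a unit eigenvector from a real positive semidefinite
matrix leaves a positive semidefinite matrix. -/
theorem Matrix.PosSemidef.sub_smul_vecMulVec_self {n : Type*} [Fintype n] [DecidableEq n]
    {A : Matrix n n ℝ} (hA : A.PosSemidef) {a : ℝ} {x : n → ℝ} (hx : x ⬝ᵥ x = 1)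
    (hAx : A *ᵥ x = a • x) : (A - a • vecMulVec x x).PosSemidef := by
  have hxA : x ᵥ* A = a • x := by
    rw [← hAx, ← vecMul_transpose, ← conjTranspose_eq_transpose_of_trivial, hA.isHermitian.eq]
  have h := hA.conjTranspose_mul_mul_same (1 - vecMulVec x x)
  convert h using 1
  simp [conjTranspose_eq_transpose_of_trivial, transpose_vecMulVec, Matrix.sub_mul,
    Matrix.mul_sub, vecMulVec_mul, mul_vecMulVec, hxA, hAx, vecMulVec_smul,
    sub_mulVec, smul_mulVec, vecMulVec_mulVec, hx]

theorem dotProduct_self_eq_one_of_evNorm_eq_one {r : ℕ} {x : Fin r → ℝ} (hx : evNorm x = 1) :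
    x ⬝ᵥ x = 1 := by
  rw [evNorm, Real.sqrt_eq_one] at hx
  simpa [dotProduct, sq] using hx

/-- If `U`, `V` are PSD with unit eigenvectors `z`, `v` for eigenvalues
`μ, ν ≥ 0`, then `μ·ν·(zᵀv)² ≤ Tr(UᵀV)`; in particular if `Tr(UᵀV) ≤ Δ` and
`μ = ν > 0`, then `(zᵀv)² ≤ Δ/μ²`. -/
theorem eigvec_overlap_le_trace {r : ℕ}
    (U V : Matrix (Fin r) (Fin r) ℝ) (hU : U.PosSemidef) (hV : V.PosSemidef)
    (μ ν : ℝ) (hμ : 0 ≤ μ) (hν : 0 ≤ ν)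
    (z v : Fin r → ℝ) (hz : evNorm z = 1) (hv : evNorm v = 1)
    (hUz : U.mulVec z = μ • z) (hVv : V.mulVec v = ν • v) :
    μ * ν * (z ⬝ᵥ v) ^ 2 ≤ (Uᵀ * V).trace ∧
    ∀ Δ : ℝ, (Uᵀ * V).trace ≤ Δ → ν = μ → 0 < μ → (z ⬝ᵥ v) ^ 2 ≤ Δ / μ ^ 2 := by
  have hz' := dotProduct_self_eq_one_of_evNorm_eq_one hz
  have hv' := dotProduct_self_eq_one_of_evNorm_eq_one hv
  have key : μ * ν * (z ⬝ᵥ v) ^ 2 ≤ (Uᵀ * V).trace := by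
    have h₁ := (hU.sub_smul_vecMulVec_self hz' hUz).trace_mul_nonneg_s7 hV
    have h₂ := mul_nonneg hμ
      ((hV.sub_smul_vecMulVec_self hv' hVv).dotProduct_mulVec_nonneg z)
    rw [← conjTranspose_eq_transpose_of_trivial, hU.isHermitian.eq]
    simp only [Matrix.sub_mul, trace_sub, smul_mul, trace_smul, vecMulVec_mul, trace_vecMulVec,
      smul_eq_mul] at h₁
    simp only [star_trivial, sub_mulVec, smul_mulVec, vecMulVec_mulVec, dotProduct_sub,
      dotProduct_smul, smul_eq_mul, op_smul_eq_smul, dotProduct_comm v z] at h₂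
    rw [dotProduct_comm, ← dotProduct_mulVec] at h₁
    linarith
  refine ⟨key, fun Δ hΔ hνμ hpos => ?_⟩
  subst hνμ
  rw [le_div_iff₀ (by positivity)]
  linarith
end

section
/- Let x_1, …, x_m be vectors in ℝ^N spanning a subspace of dimension k, and let I' ⊆ {1,…,m} with |I'| = k be such that {x_i : i ∈ I'} is linearly independent and maximizes the k-dimensional parallelepiped volume vol({x_i : i ∈ I'}) = det((x_iᵀx_j)_{i,j∈I'})^{1/2} among all k-element subsets of {1,…,m}. Then for every j ∈ {1,…,m}, writing x_j = Σ_{i∈I'} ν_i x_i (the unique such representation), one has |ν_i| ≤ 1 for all i ∈ I'. -/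
open Matrix

/-- The `k`-dimensional parallelepiped volume of a finite subfamily of vectors:
the square root of the determinant of its Gram matrix. -/
noncomputable def gramVol {N m : ℕ} (x : Fin m → (Fin N → ℝ)) (s : Finset (Fin m)) : ℝ :=
  Real.sqrt (Matrix.det (Matrix.of fun i j : s => x i ⬝ᵥ x j))

/-- The Gram determinant of the rows of `C * X` is `(det C)²` times that of the rows of `X`. -/
theorem det_mul_mul_transpose_self {ι n R : Type*} [Fintype ι] [DecidableEq ι] [Fintype n]
    [CommRing R] (C : Matrix ι ι R) (X : Matrix ι n R) :
    ((C * X) * (C * X)ᵀ).det = C.det ^ 2 * (X * Xᵀ).det := by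
  rw [transpose_mul, Matrix.mul_assoc, ← Matrix.mul_assoc X, det_mul, det_mul, det_transpose]
  ring

theorem det_one_updateRow {ι R : Type*} [Fintype ι] [DecidableEq ι] [CommRing R]
    (i : ι) (c : ι → R) : ((1 : Matrix ι ι R).updateRow i c).det = c i := by
  have h := det_updateRow_sum (1 : Matrix ι ι R) i c
  have hc : ∑ k, c k • (1 : Matrix ι ι R) k = c := by
    ext a
    simp [Matrix.one_apply]
  rwa [hc, det_one, smul_eq_mul, mul_one] at h

theorem det_mul_transpose_pos_of_linearIndependent {ι n : Type*} [Fintype ι] [DecidableEq ι]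
    [Fintype n] {X : Matrix ι n ℝ} (hX : LinearIndependent ℝ X.row) : 0 < (X * Xᵀ).det := by
  have h := Matrix.PosDef.mul_conjTranspose_self X (Matrix.vecMul_injective_iff.2 hX)
  rw [conjTranspose_eq_transpose_of_trivial] at h
  exact h.det_pos

theorem gramVol_image_univ {N m : ℕ} {ι : Type*} [Fintype ι] [DecidableEq ι]
    (x : Fin m → (Fin N → ℝ)) {f : ι → Fin m} (hf : Function.Injective f) :
    gramVol x (Finset.univ.image f) =
      Real.sqrt ((Matrix.of fun a => x (f a)) * (Matrix.of fun a => x (f a))ᵀ).det := by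
  let e : ι ≃ (Finset.univ.image f : Finset (Fin m)) :=
    Equiv.ofBijective (fun a => ⟨f a, Finset.mem_image_of_mem f (Finset.mem_univ a)⟩)
      ⟨fun a b hab => hf (congrArg Subtype.val hab), fun ⟨b, hb⟩ => by
        obtain ⟨a, -, rfl⟩ := Finset.mem_image.1 hb
        exact ⟨a, rfl⟩⟩
  rw [gramVol, ← det_submatrix_equiv_self e]
  rfl


/-- If `I'` indexes a linearly independent `k`-subfamily of `x_1, …, x_m`
(spanning a `k`-dimensional subspace) of maximum parallelepiped volume among
all `k`-element subsets, then the coefficients of any `x_j` in the basis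
`{x_i : i ∈ I'}` have absolute value at most `1`. -/
theorem max_volume_basis_coeffs_le_one {N m k : ℕ} (x : Fin m → (Fin N → ℝ))
    (hspan : Module.finrank ℝ (Submodule.span ℝ (Set.range x)) = k)
    (I' : Finset (Fin m)) (hcard : I'.card = k)
    (hindep : LinearIndependent ℝ (fun i : I' => x i))
    (hmax : ∀ s : Finset (Fin m), s.card = k → gramVol x s ≤ gramVol x I') :
    ∀ j : Fin m, ∀ ν : Fin m → ℝ,
      x j = ∑ i ∈ I', ν i • x i → ∀ i ∈ I', |ν i| ≤ 1 := by
  intro j ν hj i hi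
  by_cases hν : ν i = 0
  · simp [hν]
  let f : I' → Fin m := Function.update (fun a => (a : Fin m)) ⟨i, hi⟩ j
  let X : Matrix I' (Fin N) ℝ := Matrix.of fun a => x a
  let Y : Matrix I' (Fin N) ℝ := Matrix.of fun a => x (f a)
  let C : Matrix I' I' ℝ := (1 : Matrix I' I' ℝ).updateRow ⟨i, hi⟩ fun a => ν a
  have hY : Y = C * X := by
    ext a b
    rcases eq_or_ne a ⟨i, hi⟩ with rfl | ha
    · simp [Y, C, X, f, Matrix.mul_apply, hj, Finset.sum_apply,
        ← Finset.sum_coe_sort I' fun a => ν a * x a b]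
    · simp [Y, C, X, f, Matrix.mul_apply, ha, Matrix.one_apply]
  have hdet : (Y * Yᵀ).det = ν i ^ 2 * (X * Xᵀ).det := by
    rw [hY, det_mul_mul_transpose_self, det_one_updateRow]
  have hpos : 0 < (X * Xᵀ).det := det_mul_transpose_pos_of_linearIndependent hindep
  have hf : Function.Injective f := by
    intro a b hab
    by_contra hne
    have h0 : (Y * Yᵀ).det = 0 := det_zero_of_row_eq hne <| by
      ext c
      simp [Y, Matrix.mul_apply, hab]
    rw [hdet] at h0
    exact (mul_pos (by positivity) hpos).ne' h0
  have hle := hmax (Finset.univ.image f) (by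
    rw [Finset.card_image_of_injective _ hf, Finset.card_univ, Fintype.card_coe, hcard])
  rw [gramVol_image_univ x hf] at hle
  change √(Y * Yᵀ).det ≤ √(X * Xᵀ).det at hle
  rw [Real.sqrt_le_sqrt_iff hpos.le, hdet] at hle
  rw [← sq_le_one_iff_abs_le_one]
  exact le_of_mul_le_mul_right (by rwa [one_mul]) hpos
end

section
/- For every sufficiently large positive integer n there exists a nonempty set 𝒳 ⊆ {0,1}^n such that the semidefinite extension complexity of its convex hull satisfies xcs(conv(𝒳)) ≥ 2^{n/4} / (3 n log₂ n)^{1/4}. In particular, there is a constant c > 0 such that for every n there is a 0/1 polytope in ℝ^n whose semidefinite extension complexity is at least c · 2^{n/4}/(n log₂ n)^{1/4}. -/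
open Matrix

/-- `K` has a semidefinite extended formulation of size `r`. -/
def HasSdpEF {n : ℕ} (K : Set (Fin n → ℝ)) (r : ℕ) : Prop :=
  ∃ (m : ℕ) (a : Fin m → (Fin n → ℝ)) (U : Fin m → Matrix (Fin r) (Fin r) ℝ) (b : Fin m → ℝ),
    (∀ i, (U i).PosSemidef) ∧
    K = {x | ∃ Y : Matrix (Fin r) (Fin r) ℝ, Y.PosSemidef ∧
          ∀ i, a i ⬝ᵥ x + (U i * Y).trace = b i}

/-- Semidefinite extension complexity: the minimum size of a semidefinite EF. -/
noncomputable def xcs {n : ℕ} (K : Set (Fin n → ℝ)) : ℕ :=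
  sInf {r | HasSdpEF K r}

namespace SdpCounting

open Finset

section PosSemidef

lemma sq_apply_le_of_posSemidef {ι : Type*} {M : Matrix ι ι ℝ} (hM : M.PosSemidef) (i j : ι) :
    M i j ^ 2 ≤ M i i * M j j := by
  have hdet := (hM.submatrix ![i, j]).det_nonneg
  have hsymm : M j i = M i j := by simpa using hM.isHermitian.apply i j
  rw [Matrix.det_fin_two] at hdet
  simp only [submatrix_apply, cons_val_zero, cons_val_one, hsymm] at hdet
  nlinarith

variable {ι κ : Type*} [Fintype ι] [DecidableEq ι]

/-- A symmetric matrix with entries bounded by `ε` is bounded below by `-(card ι) ε`. -/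
lemma posSemidef_add_smul_one {E : Matrix ι ι ℝ} (hE : E.IsHermitian) {ε : ℝ}
    (hε : ∀ i j, |E i j| ≤ ε) :
    (E + (ε * Fintype.card ι) • (1 : Matrix ι ι ℝ)).PosSemidef := by
  refine PosSemidef.of_dotProduct_mulVec_nonneg
    (hE.add (by simp [IsHermitian])) fun u => ?_
  have hterm : ∀ i j, -(ε / 2) * (u i ^ 2 + u j ^ 2) ≤ u i * (E i j * u j) := fun i j => by
    have h := abs_le.mp (hε i j)
    have hε0 : 0 ≤ ε := (abs_nonneg _).trans (hε i j)
    nlinarith [mul_nonneg (by linarith : 0 ≤ ε - E i j) (sq_nonneg (u i - u j)),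
      mul_nonneg (by linarith : 0 ≤ ε + E i j) (sq_nonneg (u i + u j))]
  have hsum : ∑ i, ∑ j, -(ε / 2) * (u i ^ 2 + u j ^ 2) ≤ ∑ i, ∑ j, u i * (E i j * u j) :=
    sum_le_sum fun i _ => sum_le_sum fun j _ => hterm i j
  have hleft : ∑ i, ∑ j, -(ε / 2) * (u i ^ 2 + u j ^ 2) =
      -(ε * Fintype.card ι * ∑ i, u i ^ 2) := by
    simp only [← mul_sum, sum_add_distrib, sum_const, card_univ, nsmul_eq_mul]
    ring
  have hright : star u ⬝ᵥ E *ᵥ u = ∑ i, ∑ j, u i * (E i j * u j) := by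
    simp [dotProduct, mulVec, mul_sum]
  have hone : star u ⬝ᵥ u = ∑ i, u i ^ 2 := by simp [dotProduct, sq]
  rw [add_mulVec, dotProduct_add, smul_mulVec, one_mulVec, dotProduct_smul, hright, hone,
    smul_eq_mul]
  linarith

/-- A family of positive semidefinite matrices can be transformed so that it sums to the identity,
without creating new positive semidefinite affine combinations. -/
lemma exists_sum_eq_one {A : Finset κ} (hA : A.Nonempty) {Y : κ → Matrix ι ι ℝ}
    (hY : ∀ v ∈ A, (Y v).PosSemidef) :
    ∃ W : κ → Matrix ι ι ℝ, (∀ v ∈ A, (W v).PosSemidef) ∧ ∑ v ∈ A, W v = 1 ∧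
      ∀ c : κ → ℝ, (∑ v ∈ A, c v • W v).PosSemidef → (∑ v ∈ A, c v • Y v).PosSemidef := by
  have hZ : (∑ v ∈ A, Y v).PosSemidef := posSemidef_sum A hY
  set d := hZ.1.eigenvalues with hd
  set U := (hZ.1.eigenvectorUnitary : Matrix ι ι ℝ) with hU
  have hd0 : ∀ i, 0 ≤ d i := hZ.eigenvalues_nonneg
  have hdiag : Uᴴ * (∑ v ∈ A, Y v) * U = diagonal d := by
    have := hZ.1.conjStarAlgAut_star_eigenvectorUnitary
    rw [Unitary.conjStarAlgAut_star_apply] at this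
    simpa [star_eq_conjTranspose] using! this
  have hUunit : IsUnit U :=
    (Unitary.toUnits hZ.1.eigenvectorUnitary).isUnit
  set s : ι → ℝ := fun i => if d i = 0 then 1 else (√(d i))⁻¹ with hs
  have hs0 : ∀ i, s i ≠ 0 := fun i => by
    by_cases h : d i = 0
    · simp [hs, h]
    · simpa [hs, h] using (Real.sqrt_ne_zero (hd0 i)).mpr h
  set B := U * diagonal s with hB
  have hBunit : IsUnit B := hUunit.mul ((isUnit_diagonal).mpr
    (Pi.isUnit_iff.mpr fun i => (hs0 i).isUnit))
  set V : κ → Matrix ι ι ℝ := fun v => Bᴴ * Y v * B with hV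
  have hVpsd : ∀ v ∈ A, (V v).PosSemidef := fun v hv => (hY v hv).conjTranspose_mul_mul_same B
  have hVsum : ∀ c : κ → ℝ, ∑ v ∈ A, c v • V v = Bᴴ * (∑ v ∈ A, c v • Y v) * B := fun c => by
    simp only [hV, Matrix.mul_sum, Matrix.sum_mul, Matrix.mul_smul, Matrix.smul_mul]
  have hVone : ∑ v ∈ A, V v = diagonal fun i => if d i = 0 then 0 else 1 := by
    have h1 := hVsum 1
    simp only [Pi.one_apply, one_smul] at h1
    rw [h1, hB, conjTranspose_mul]
    have : (diagonal s)ᴴ * Uᴴ * (∑ v ∈ A, Y v) * (U * diagonal s) =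
        (diagonal s)ᴴ * (Uᴴ * (∑ v ∈ A, Y v) * U) * diagonal s := by
      simp only [Matrix.mul_assoc]
    rw [this, hdiag, diagonal_conjTranspose, diagonal_mul_diagonal, diagonal_mul_diagonal]
    congr 1
    ext i
    by_cases h : d i = 0
    · simp [hs, h]
    · have h2 := Real.mul_self_sqrt (hd0 i)
      have h3 := (Real.sqrt_ne_zero (hd0 i)).mpr h
      simp only [hs, h, if_false, star_trivial, Pi.star_apply]
      field_simp
      nlinarith
  have hVzero : ∀ v ∈ A, ∀ i j, d i = 0 ∨ d j = 0 → V v i j = 0 := by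
    have hzero : ∀ v ∈ A, ∀ i, d i = 0 → V v i i = 0 := fun v hv i hi => by
      have h := congrFun (congrFun hVone i) i
      rw [Matrix.sum_apply, diagonal_apply_eq, if_pos hi] at h
      exact (sum_eq_zero_iff_of_nonneg fun w hw => (hVpsd w hw).diag_nonneg).mp h v hv
    intro v hv i j hij
    have hsq := sq_apply_le_of_posSemidef (hVpsd v hv) i j
    have : V v i i * V v j j = 0 := by
      rcases hij with h | h <;> simp [hzero v hv _ h]
    exact pow_eq_zero_iff two_ne_zero |>.mp (le_antisymm (this ▸ hsq) (sq_nonneg _))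
  set Q : Matrix ι ι ℝ := diagonal fun i => if d i = 0 then 1 else 0 with hQ
  have hQpsd : Q.PosSemidef := PosSemidef.diagonal fun i => by
    simp only [Pi.zero_apply]; split_ifs <;> norm_num
  have hcard : (A.card : ℝ) ≠ 0 := by exact_mod_cast hA.card_pos.ne'
  refine ⟨fun v => V v + (A.card : ℝ)⁻¹ • Q,
    fun v hv => (hVpsd v hv).add (hQpsd.smul (by positivity)), ?_, fun c hc => ?_⟩
  · rw [sum_add_distrib, hVone, sum_const, ← Nat.cast_smul_eq_nsmul ℝ, smul_smul,
      mul_inv_cancel₀ hcard, one_smul, hQ, diagonal_add, ← diagonal_one]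
    congr 1
    ext i
    split_ifs <;> norm_num
  · set P : Matrix ι ι ℝ := diagonal fun i => if d i = 0 then 0 else 1 with hP
    have hproj : Pᴴ * (∑ v ∈ A, c v • (V v + (A.card : ℝ)⁻¹ • Q)) * P = ∑ v ∈ A, c v • V v := by
      ext i j
      rw [hP, diagonal_conjTranspose, mul_diagonal, diagonal_mul]
      simp only [Matrix.sum_apply, Matrix.smul_apply, Matrix.add_apply, Pi.star_apply,
        star_trivial, smul_eq_mul]
      by_cases hij : d i = 0 ∨ d j = 0
      · rw [sum_eq_zero (s := A) (f := fun v => c v * V v i j)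
          fun v hv => by rw [hVzero v hv i j hij, mul_zero]]
        rcases hij with h | h <;> simp [h]
      · push Not at hij
        have hQij : Q i j = 0 := by
          rw [hQ, diagonal_apply]; simp [hij.1]
        simp [hij.1, hij.2, hQij]
    have hpsd := hc.conjTranspose_mul_mul_same P
    rw [hproj, hVsum] at hpsd
    exact (IsUnit.posSemidef_star_left_conjugate_iff hBunit).mp hpsd

end PosSemidef

section Cube

variable {n : ℕ}

/-- The vertex of the cube `[0,1]ⁿ` with the given coordinates. -/
def cubePoint (v : Fin n → Bool) : Fin n → ℝ := fun k => if v k then 1 else 0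

lemma cubePoint_nonneg (v : Fin n → Bool) (k : Fin n) : 0 ≤ cubePoint v k := by
  unfold cubePoint; split_ifs <;> norm_num

lemma cubePoint_le_one (v : Fin n → Bool) (k : Fin n) : cubePoint v k ≤ 1 := by
  unfold cubePoint; split_ifs <;> norm_num

lemma mem_convexHull_cubePoint_iff {A : Finset (Fin n → Bool)} {y : Fin n → ℝ} :
    y ∈ convexHull ℝ (cubePoint '' (A : Set (Fin n → Bool))) ↔
      ∃ w : (Fin n → Bool) → ℝ, (∀ v ∈ A, 0 ≤ w v) ∧ ∑ v ∈ A, w v = 1 ∧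
        ∑ v ∈ A, w v • cubePoint v = y := by
  constructor
  · refine fun hy => convexHull_min (t := {y | ∃ w : (Fin n → Bool) → ℝ, (∀ v ∈ A, 0 ≤ w v) ∧
      ∑ v ∈ A, w v = 1 ∧ ∑ v ∈ A, w v • cubePoint v = y}) ?_ ?_ hy
    · rintro _ ⟨v, hv, rfl⟩
      refine ⟨Pi.single v 1, fun u _ => ?_, ?_, ?_⟩
      · by_cases h : u = v
        · subst h; simp
        · simp [h]
      · simpa using hv
      · simp only [Pi.single_apply, ite_smul, one_smul, zero_smul, sum_ite_eq']
        exact if_pos hv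
    · rintro _ ⟨w, hw, hw1, rfl⟩ _ ⟨w', hw', hw1', rfl⟩ a b ha hb hab
      refine ⟨fun v => a * w v + b * w' v, fun v hv =>
        add_nonneg (mul_nonneg ha (hw v hv)) (mul_nonneg hb (hw' v hv)), ?_, ?_⟩
      · rw [sum_add_distrib, ← mul_sum, ← mul_sum, hw1, hw1', mul_one, mul_one, hab]
      · simp only [add_smul, mul_smul, sum_add_distrib, smul_sum]
  · rintro ⟨w, hw, hw1, rfl⟩
    exact (convex_convexHull ℝ _).sum_mem hw hw1 fun v hv =>
      subset_convexHull ℝ _ ⟨v, hv, rfl⟩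

lemma mem_of_cubePoint_mem_convexHull {A : Finset (Fin n → Bool)} {x : Fin n → Bool}
    (hx : cubePoint x ∈ convexHull ℝ (cubePoint '' (A : Set (Fin n → Bool)))) : x ∈ A := by
  obtain ⟨w, hw, hw1, hwx⟩ := mem_convexHull_cubePoint_iff.mp hx
  obtain ⟨v, hv, hv0⟩ : ∃ v ∈ A, w v ≠ 0 :=
    exists_ne_zero_of_sum_ne_zero (by rw [hw1]; exact one_ne_zero)
  suffices v = x from this ▸ hv
  ext1 k
  have hk : ∑ u ∈ A, w u * cubePoint u k = cubePoint x k := by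
    simpa [Finset.sum_apply] using congrFun hwx k
  cases hxk : x k with
  | false =>
    have h0 : ∑ u ∈ A, w u * cubePoint u k = 0 := by rw [hk]; simp [cubePoint, hxk]
    have := (sum_eq_zero_iff_of_nonneg fun u hu =>
      mul_nonneg (hw u hu) (cubePoint_nonneg u k)).mp h0 v hv
    simpa [hv0, cubePoint] using this
  | true =>
    have h0 : ∑ u ∈ A, w u * (1 - cubePoint u k) = 0 := by
      simp only [mul_sub, mul_one, sum_sub_distrib, hk, hw1]; simp [cubePoint, hxk]
    have := (sum_eq_zero_iff_of_nonneg fun u hu =>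
      mul_nonneg (hw u hu) (sub_nonneg.mpr (cubePoint_le_one u k))).mp h0 v hv
    by_contra h
    simp [hv0, cubePoint, h] at this

lemma hasSdpEF_convexHull_cubePoint (A : Finset (Fin n → Bool)) :
    HasSdpEF (convexHull ℝ (cubePoint '' (A : Set (Fin n → Bool)))) A.card := by
  let f : Fin A.card ≃ A := A.equivFin.symm
  refine ⟨n + 1, Fin.cons 0 fun k => Pi.single k (-1),
    Fin.cons 1 fun k => diagonal fun j => cubePoint (f j).1 k, Fin.cons 1 0, ?_, ?_⟩
  · refine Fin.cases ?_ fun k => ?_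
    · exact PosSemidef.one
    · exact PosSemidef.diagonal fun j => cubePoint_nonneg _ k
  ext x
  have htr : ∀ (k : Fin n) (Y : Matrix (Fin A.card) (Fin A.card) ℝ),
      (diagonal (fun j => cubePoint (f j).1 k) * Y).trace = ∑ j, cubePoint (f j).1 k * Y j j :=
    fun k Y => by simp [Matrix.trace, diagonal_mul]
  have hreindex : ∀ g : (Fin n → Bool) → ℝ, ∑ j, g (f j).1 = ∑ v ∈ A, g v := fun g => by
    rw [Equiv.sum_comp f fun v => g v.1, sum_coe_sort A g]
  rw [mem_convexHull_cubePoint_iff, Set.mem_ofPred_eq]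
  simp only [Fin.forall_fin_succ, Fin.cons_zero, Fin.cons_succ, zero_dotProduct, Matrix.one_mul,
    zero_add, single_dotProduct, htr, Pi.zero_apply]
  constructor
  · rintro ⟨w, hw, hw1, rfl⟩
    refine ⟨diagonal fun j => w (f j).1, PosSemidef.diagonal fun j => hw _ (f j).2, ?_, ?_⟩
    · rw [trace_diagonal, hreindex, hw1]
    · intro k
      simp only [diagonal_apply_eq]
      rw [hreindex fun v => cubePoint v k * w v]
      simp [Finset.sum_apply, mul_comm]
  · rintro ⟨Y, hY, hY1, hYx⟩
    let w : (Fin n → Bool) → ℝ := fun v => if hv : v ∈ A then Y (f.symm ⟨v, hv⟩) (f.symm ⟨v, hv⟩)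
      else 0
    have hw : ∀ j, w (f j).1 = Y j j := fun j => by simp [w]
    refine ⟨w, fun v hv => ?_, ?_, ?_⟩
    · simp only [w, dif_pos hv]; exact hY.diag_nonneg
    · rw [← hreindex]; simpa [hw, Matrix.trace] using hY1
    · ext k
      have h := hYx k
      have h2 := hreindex fun v => cubePoint v k * w v
      simp only [hw] at h2
      simp only [Finset.sum_apply, Pi.smul_apply, smul_eq_mul, mul_comm (w _)]
      linarith

lemma exists_matrix_family_of_hasSdpEF {A : Finset (Fin n → Bool)} {r R : ℕ} (hrR : r ≤ R)
    (hEF : HasSdpEF (convexHull ℝ (cubePoint '' (A : Set (Fin n → Bool)))) r) :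
    ∃ Y : (Fin n → Bool) → Matrix (Fin R) (Fin R) ℝ, (∀ v ∈ A, (Y v).PosSemidef) ∧
      ∀ c : (Fin n → Bool) → ℝ, ∑ v ∈ A, c v = 1 → (∑ v ∈ A, c v • Y v).PosSemidef →
        ∑ v ∈ A, c v • cubePoint v ∈ convexHull ℝ (cubePoint '' (A : Set (Fin n → Bool))) := by
  obtain ⟨m, a, U, b, -, hK⟩ := hEF
  have hmem : ∀ v : Fin n → Bool, ∃ Y : Matrix (Fin r) (Fin r) ℝ, v ∈ A → Y.PosSemidef ∧
      ∀ i, a i ⬝ᵥ cubePoint v + (U i * Y).trace = b i := fun v => by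
    by_cases hv : v ∈ A
    · have h : cubePoint v ∈ convexHull ℝ (cubePoint '' (A : Set (Fin n → Bool))) :=
        subset_convexHull ℝ _ ⟨v, hv, rfl⟩
      rw [hK] at h
      exact h.imp fun Y hY _ => hY
    · exact ⟨0, fun h => absurd h hv⟩
  choose Y hY using hmem
  let J : Matrix (Fin R) (Fin r) ℝ := (1 : Matrix (Fin R) (Fin R) ℝ).submatrix id (Fin.castLE hrR)
  have hJ : Jᴴ * J = 1 := by
    simp only [J, conjTranspose_submatrix, conjTranspose_one]
    rw [submatrix_mul _ _ _ id _ Function.bijective_id |>.symm, Matrix.one_mul]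
    exact submatrix_one _ (Fin.castLE_injective hrR)
  refine ⟨fun v => J * Y v * Jᴴ, fun v hv => (hY v hv).1.mul_mul_conjTranspose_same J,
    fun c hc hpsd => ?_⟩
  have hcancel : Jᴴ * (∑ v ∈ A, c v • (J * Y v * Jᴴ)) * J = ∑ v ∈ A, c v • Y v := by
    have : ∀ v, Jᴴ * (J * Y v * Jᴴ) * J = Y v := fun v => by
      rw [← Matrix.mul_assoc, ← Matrix.mul_assoc, hJ, Matrix.one_mul, Matrix.mul_assoc, hJ,
        Matrix.mul_one]
    simp only [Matrix.mul_sum, Matrix.sum_mul, Matrix.mul_smul, Matrix.smul_mul, this]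
  rw [hK]
  refine ⟨∑ v ∈ A, c v • Y v, hcancel ▸ hpsd.conjTranspose_mul_mul_same J, fun i => ?_⟩
  rw [dotProduct_sum, Matrix.mul_sum, trace_sum, ← sum_add_distrib]
  simp only [dotProduct_smul, Matrix.mul_smul, trace_smul, ← smul_add]
  rw [sum_congr rfl fun v hv => by rw [(hY v hv).2 i], ← sum_smul, hc, one_smul]

end Cube

section BarycentricSpanner

open Module Submodule

variable {V κ : Type*} [AddCommGroup V] [Module ℝ V]

lemma exists_barycentric_spanner_of_span_eq_top {ι : Type*} [Fintype ι] [DecidableEq ι] [Finite κ]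
    (b : Basis ι ℝ V) {w : κ → V} (hw : span ℝ (Set.range w) = ⊤) :
    ∃ e : ι → κ, ∀ v, ∃ c : ι → ℝ, (∀ i, |c i| ≤ 1) ∧ w v = ∑ i, c i • w (e i) := by
  classical
  obtain ⟨e₀, he₀⟩ : ∃ e : ι → κ, b.det (w ∘ e) ≠ 0 := by
    obtain ⟨κ', a, -, hspan, hli⟩ := exists_linearIndependent' ℝ w
    let b' := Basis.mk hli (hspan.trans hw).ge
    let σ := b.indexEquiv b'
    refine ⟨a ∘ σ, ?_⟩
    have : w ∘ a ∘ σ = b'.reindex σ.symm := by ext i; simp [b']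
    rw [this]
    exact (b.isUnit_det _).ne_zero
  have : Nonempty (ι → κ) := ⟨e₀⟩
  obtain ⟨e, he⟩ := Finite.exists_max fun e : ι → κ => |b.det (w ∘ e)|
  have hpos : 0 < |b.det (w ∘ e)| := (abs_pos.mpr he₀).trans_le (he e₀)
  have hdet := abs_pos.mp hpos
  obtain ⟨hli, hspan⟩ := b.is_basis_iff_det.mpr hdet.isUnit
  refine ⟨e, fun v => ⟨fun i => (Basis.mk hli hspan.ge).repr (w v) i, fun i => ?_, ?_⟩⟩
  · have h := LinearMap.congr_fun (b.det_smul_mk_coord_eq_det_update hli hspan.ge i) (w v)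
    simp only [LinearMap.smul_apply, smul_eq_mul, Basis.coord_apply,
      MultilinearMap.toLinearMap_apply, AlternatingMap.coe_multilinearMap] at h
    have hupd : Function.update (w ∘ e) i (w v) = w ∘ Function.update e i v := by
      rw [Function.comp_update]
    rw [hupd] at h
    have hle := he (Function.update e i v)
    replace h := congrArg abs h
    rw [abs_mul] at h
    exact le_of_mul_le_mul_left ((h.trans_le hle).trans_eq (mul_one _).symm) hpos
  · simpa using ((Basis.mk hli hspan.ge).sum_repr (w v)).symm

lemma exists_barycentric_spanner [FiniteDimensional ℝ V] {A : Finset κ} (hA : A.Nonempty)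
    (w : κ → V) {m : ℕ} (hm : finrank ℝ V ≤ m) :
    ∃ e : Fin m → κ, (∀ i, e i ∈ A) ∧
      ∀ v ∈ A, ∃ c : Fin m → ℝ, (∀ i, |c i| ≤ 1) ∧ w v = ∑ i, c i • w (e i) := by
  obtain ⟨v₀, hv₀⟩ := hA
  let S := span ℝ (Set.range fun v : A => w v)
  let w' : A → S := fun v => ⟨w v, subset_span ⟨v, rfl⟩⟩
  have hspan : span ℝ (Set.range w') = ⊤ := by
    apply map_injective_of_injective S.injective_subtype
    rw [map_span, Submodule.map_top, range_subtype, ← Set.range_comp]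
    rfl
  obtain ⟨e, he⟩ := exists_barycentric_spanner_of_span_eq_top (finBasis ℝ S) hspan
  have hdm : finrank ℝ S ≤ m := (finrank_le S).trans hm
  let g : Fin m → A := fun i => if h : i.1 < finrank ℝ S then e ⟨i, h⟩ else ⟨v₀, hv₀⟩
  refine ⟨fun i => g i, fun i => (g i).2, fun v hv => ?_⟩
  obtain ⟨c, hc, hcv⟩ := he ⟨v, hv⟩
  refine ⟨fun i => if h : i.1 < finrank ℝ S then c ⟨i, h⟩ else 0, fun i => ?_, ?_⟩
  · by_cases h : i.1 < finrank ℝ S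
    · simpa [h] using hc ⟨i, h⟩
    · simp [h]
  · have h := congrArg (Subtype.val : S → V) hcv
    simp only [w', AddSubmonoidClass.coe_finsetSum, Submodule.coe_smul] at h
    rw [h]
    refine Fintype.sum_of_injective (Fin.castLE hdm) (Fin.castLE_injective hdm) _ _ ?_ ?_
    · intro i hi
      have : ¬ i.1 < finrank ℝ S := fun h => hi ⟨⟨i, h⟩, rfl⟩
      simp [this]
    · intro i
      simp [g]

end BarycentricSpanner

section BasicSolution

variable {ι E : Type*} [Fintype ι] [AddCommGroup E] [Module ℝ E]

/-- A nonnegative combination can be rewritten over linearly independent vectors without increasing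
the coefficient at `i₀`, provided `i₀` is the only index where `φ` is not positive. -/
lemma exists_basic_solution (col : ι → E) (φ : E →ₗ[ℝ] ℝ) (i₀ : ι)
    (hφ : ∀ i, i ≠ i₀ → 0 < φ (col i)) {y : ι → ℝ} (hy : ∀ i, 0 ≤ y i) :
    ∃ z : ι → ℝ, (∀ i, 0 ≤ z i) ∧ ∑ i, z i • col i = ∑ i, y i • col i ∧ z i₀ ≤ y i₀ ∧
      LinearIndependent ℝ fun i : {i // z i ≠ 0} => col i := by
  classical
  suffices H : ∀ (k : ℕ) (y : ι → ℝ), (∀ i, 0 ≤ y i) → #{i | y i ≠ 0} = k →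
      ∃ z : ι → ℝ, (∀ i, 0 ≤ z i) ∧ ∑ i, z i • col i = ∑ i, y i • col i ∧ z i₀ ≤ y i₀ ∧
        LinearIndependent ℝ fun i : {i // z i ≠ 0} => col i from H _ y hy rfl
  intro k
  induction k using Nat.strong_induction_on with
  | _ k ih =>
  intro y hy hk
  by_cases hli : LinearIndependent ℝ fun i : {i // y i ≠ 0} => col i
  · exact ⟨y, hy, rfl, le_rfl, hli⟩
  obtain ⟨d, hd0, hdy, hsum, hdneg, hdi₀⟩ : ∃ d : ι → ℝ, (∀ i, y i = 0 → d i = 0) ∧ d ≠ 0 ∧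
      ∑ i, d i • col i = 0 ∧ (∃ i, d i < 0) ∧ d i₀ ≤ 0 := by
    obtain ⟨g, hg, ⟨i₁, hi₁⟩, hgi₁⟩ := Fintype.not_linearIndependent_iff.mp hli
    obtain ⟨d, hd0, hd1, hds, hdi⟩ : ∃ d : ι → ℝ, (∀ i, y i = 0 → d i = 0) ∧ d i₁ ≠ 0 ∧
        ∑ i, d i • col i = 0 ∧ d i₀ ≤ 0 := by
      let f : ι → ℝ := fun i => if h : y i ≠ 0 then g ⟨i, h⟩ else 0
      have hf0 : ∀ i, y i = 0 → f i = 0 := fun i hi => by simp [f, hi]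
      have hf1 : f i₁ ≠ 0 := by simpa [f, hi₁] using hgi₁
      have hfs : ∑ i, f i • col i = 0 := by
        rw [← hg]
        symm
        refine Fintype.sum_of_injective Subtype.val Subtype.val_injective _ _ ?_ ?_
        · intro i hi
          have : y i = 0 := by
            by_contra h
            exact hi ⟨⟨i, h⟩, rfl⟩
          simp [hf0 i this]
        · rintro ⟨i, hi⟩
          simp [f, hi]
      rcases le_total (f i₀) 0 with h | h
      · exact ⟨f, hf0, hf1, hfs, h⟩
      · exact ⟨-f, fun i hi => by simp [hf0 i hi], by simpa using hf1, by simp [hfs], by simpa⟩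
    refine ⟨d, hd0, fun h => hd1 (by simp [h]), hds, ?_, hdi⟩
    by_contra! hnonneg
    have hzero : d i₀ = 0 := le_antisymm hdi (hnonneg i₀)
    have hφsum : ∑ i, d i * φ (col i) = 0 := by
      simpa using congrArg φ hds
    have hterm : ∀ i ∈ univ, 0 ≤ d i * φ (col i) := fun i _ => by
      by_cases h : i = i₀
      · simp [h, hzero]
      · exact mul_nonneg (hnonneg i) (hφ i h).le
    have h1 := (sum_eq_zero_iff_of_nonneg hterm).mp hφsum i₁ (mem_univ _)
    have hne : i₁ ≠ i₀ := fun h => hd1 (h ▸ hzero)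
    exact (mul_ne_zero hd1 (hφ i₁ hne).ne') h1
  obtain ⟨i₁, hi₁, hmin⟩ := exists_min_image {i | d i < 0} (fun i => y i / -d i)
    (hdneg.imp fun i hi => by simpa using hi)
  simp only [mem_filter, mem_univ, true_and] at hi₁ hmin
  set θ := y i₁ / -d i₁ with hθ
  have hθ0 : 0 ≤ θ := div_nonneg (hy i₁) (by linarith)
  have hy' : ∀ i, 0 ≤ y i + θ * d i := fun i => by
    rcases lt_or_ge (d i) 0 with h | h
    · have := (le_div_iff₀ (by linarith : 0 < -d i)).mp (hmin i h)
      linarith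
    · exact add_nonneg (hy i) (mul_nonneg hθ0 h)
  have hzero : y i₁ + θ * d i₁ = 0 := by
    rw [hθ]; field_simp [hi₁.ne]; ring
  have hlt : #{i | y i + θ * d i ≠ 0} < k := by
    rw [← hk]
    refine card_lt_card ⟨fun i hi => ?_, fun h => ?_⟩
    · simp only [mem_filter, mem_univ, true_and] at hi ⊢
      intro h
      exact hi (by rw [h, hd0 i h]; ring)
    · have h1 : i₁ ∈ ({i | y i ≠ 0} : Finset ι) := by
        simp only [mem_filter, mem_univ, true_and]
        exact fun h => hi₁.ne (hd0 i₁ h)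
      simpa [hzero] using h h1
  obtain ⟨z, hz, hzsum, hzi₀, hzli⟩ := ih _ hlt _ hy' rfl
  refine ⟨z, hz, hzsum.trans ?_, hzi₀.trans ?_, hzli⟩
  · simp only [add_smul, mul_smul, sum_add_distrib, ← smul_sum, hsum, smul_zero, add_zero]
  · nlinarith

/-- Cramer's rule for the normal equations: in an integral system with linearly independent
columns, positive coordinates of the solution are at least the inverse of the Gram determinant. -/
lemma one_le_mul_det_gram {ι κ : Type*} [Fintype ι] [Fintype κ] [DecidableEq ι]
    (C : Matrix κ ι ℤ) {e : κ → ℤ} {y : ι → ℝ}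
    (hli : LinearIndependent ℝ fun i => fun k => (C k i : ℝ))
    (hy : C.map (Int.cast : ℤ → ℝ) *ᵥ y = fun k => (e k : ℝ)) {i : ι} (hi : 0 < y i) :
    1 ≤ y i * |((Cᵀ * C).det : ℝ)| := by
  set D := C.map (Int.cast : ℤ → ℝ) with hD
  have hdet : (Dᵀ * D).det ≠ 0 := by
    have hinj : Function.Injective D.mulVec := mulVec_injective_iff.mpr hli
    simpa using (PosDef.conjTranspose_mul_self D hinj).det_pos.ne'
  have hcast : (Cᵀ * C).map (Int.cast : ℤ → ℝ) = Dᵀ * D := by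
    rw [hD, ← transpose_map]; exact Matrix.map_mul (f := Int.castRingHom ℝ)
  have hdetcast : ((Cᵀ * C).det : ℝ) = (Dᵀ * D).det := by
    rw [Int.cast_det]; exact congrArg det hcast
  have hadj : ((Cᵀ * C).adjugate).map (Int.cast : ℤ → ℝ) = (Dᵀ * D).adjugate := by
    rw [← hcast]; exact (Int.castRingHom ℝ).map_adjugate _
  have hcramer : (Dᵀ * D).det * y i =
      ((((Cᵀ * C).adjugate *ᵥ (Cᵀ *ᵥ e)) i : ℤ) : ℝ) := by
    have h1 : (Dᵀ * D).adjugate *ᵥ (Dᵀ *ᵥ (D *ᵥ y)) = (Dᵀ * D).det • y := by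
      rw [mulVec_mulVec, mulVec_mulVec, Matrix.mul_assoc, adjugate_mul, smul_mulVec, one_mulVec]
    have h2 := congrFun h1 i
    rw [Pi.smul_apply, smul_eq_mul] at h2
    rw [← h2, hy, ← hadj]
    simp [hD, mulVec, dotProduct]
  have hne : ((Cᵀ * C).adjugate *ᵥ (Cᵀ *ᵥ e)) i ≠ 0 := fun h => by
    rw [h, Int.cast_zero] at hcramer
    exact (mul_ne_zero hdet hi.ne') hcramer
  calc (1 : ℝ) ≤ |((((Cᵀ * C).adjugate *ᵥ (Cᵀ *ᵥ e)) i : ℤ) : ℝ)| := by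
        exact_mod_cast Int.one_le_abs hne
    _ = y i * |((Cᵀ * C).det : ℝ)| := by
        rw [← hcramer, hdetcast, abs_mul, abs_of_pos hi, mul_comm]

lemma abs_det_le_of_scaled_entries {ι : Type*} [Fintype ι] [DecidableEq ι] (G : Matrix ι ι ℝ)
    {M : ℝ} (a : ι → ℝ) (hG : ∀ i j, |G i j| ≤ M * (a i * a j)) :
    |G.det| ≤ (Fintype.card ι).factorial * (M ^ Fintype.card ι * (∏ i, a i) ^ 2) := by
  rw [det_apply]
  calc |∑ σ : Equiv.Perm ι, Equiv.Perm.sign σ • ∏ i, G (σ i) i|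
      ≤ ∑ σ : Equiv.Perm ι, |Equiv.Perm.sign σ • ∏ i, G (σ i) i| := abs_sum_le_sum_abs _ _
    _ ≤ ∑ _σ : Equiv.Perm ι, M ^ Fintype.card ι * (∏ i, a i) ^ 2 := by
        refine sum_le_sum fun σ _ => ?_
        have habs : |Equiv.Perm.sign σ • ∏ i, G (σ i) i| = ∏ i, |G (σ i) i| := by
          rw [← abs_prod]
          rcases Int.units_eq_one_or (Equiv.Perm.sign σ) with h | h <;> simp [h]
        rw [habs]
        refine (prod_le_prod (fun i _ => abs_nonneg _) fun i _ => hG (σ i) i).trans_eq ?_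
        rw [prod_mul_distrib, prod_mul_distrib, Equiv.prod_comp σ a, prod_const, card_univ, sq]
    _ = _ := by
        rw [sum_const, card_univ, Fintype.card_perm, nsmul_eq_mul]

end BasicSolution

section Gap

variable {n : ℕ}

/-- A cube vertex outside the hull of `A` cannot be pushed into the (homogenized) hull by adding a
small multiple of the sum of the vertices in `A`. -/
lemma mem_of_add_smul_sum_mem_cone {A : Finset (Fin n → Bool)} {x : Fin n → Bool} {δ : ℝ}
    (hδ : 0 ≤ δ) {w : (Fin n → Bool) → ℝ} (hw : ∀ v ∈ A, 0 ≤ w v)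
    (hsum : ∑ v ∈ A, w v = 1 + δ * A.card)
    (hpt : ∑ v ∈ A, w v • cubePoint v = cubePoint x + δ • ∑ v ∈ A, cubePoint v)
    (hsmall : δ * ((n + 1).factorial * ((n + 1) ^ (n + 1) * A.card ^ 2)) < 1) : x ∈ A := by
  classical
  let h : (Fin n → Bool) → Option (Fin n) → ℤ := fun v k => k.elim 1 fun k => if v k then 1 else 0
  let C : Matrix (Option (Fin n)) (Option A) ℤ := fun k i =>
    i.elim (-∑ v ∈ A, h v k) fun v => h v k
  let y : Option A → ℝ := fun i => i.elim δ fun v => w v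
  have hcast : ∀ v k, (h v (some k) : ℝ) = cubePoint v k := fun v k => by
    simp only [h, cubePoint, Option.elim_some]; split_ifs <;> simp
  have hcomb : ∀ (z : Option A → ℝ) k, (∑ i, z i • fun k => (C k i : ℝ)) k =
      -(z none * ∑ v ∈ A, (h v k : ℝ)) + ∑ v : A, z (some v) * (h v k : ℝ) := fun z k => by
    simp [Fintype.sum_option, Finset.sum_apply, C]
  have hy : ∑ i, y i • (fun k => (C k i : ℝ)) = fun k => (h x k : ℝ) := by
    ext k
    rw [hcomb]
    simp only [y, Option.elim_none, Option.elim_some]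
    rw [sum_coe_sort A fun v => w v * (h v k : ℝ)]
    cases k with
    | none => simp [h, hsum]
    | some k =>
      have hk := congrFun hpt k
      simp only [Finset.sum_apply, Pi.smul_apply, Pi.add_apply, smul_eq_mul] at hk
      simp only [hcast, hk]
      ring
  obtain ⟨z, hz, hzsum, hzδ, hzli⟩ := exists_basic_solution (fun i k => (C k i : ℝ))
    (LinearMap.proj none) none (y := y) (fun i hi => by
      cases i with
      | none => exact absurd rfl hi
      | some v => simp [C, h]) (fun i => by
      cases i with
      | none => exact hδ
      | some v => exact hw v v.2)
  rw [hy] at hzsum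
  have hzk : ∀ k, -(z none * ∑ v ∈ A, (h v k : ℝ)) + ∑ v : A, z (some v) * (h v k : ℝ) =
      h x k := fun k => by rw [← hcomb, hzsum]
  rcases eq_or_lt_of_le (hz none) with h0 | h0
  · refine mem_of_cubePoint_mem_convexHull (mem_convexHull_cubePoint_iff.mpr
      ⟨fun v => if hv : v ∈ A then z (some ⟨v, hv⟩) else 0, fun v hv => ?_, ?_, ?_⟩)
    · simpa [hv] using hz (some ⟨v, hv⟩)
    · have := hzk none
      rw [← sum_coe_sort]
      simpa [← h0, h] using this
    · ext k
      have := hzk (some k)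
      rw [← sum_coe_sort]
      simpa [← h0, hcast, Finset.sum_apply] using this
  · exfalso
    let C' : Matrix (Option (Fin n)) {i // z i ≠ 0} ℤ := C.submatrix id Subtype.val
    have hsol : C'.map (Int.cast : ℤ → ℝ) *ᵥ (fun i => z i) = fun k => (h x k : ℝ) := by
      rw [← hzsum]
      ext k
      simp only [mulVec, dotProduct, C', Finset.sum_apply, Pi.smul_apply, smul_eq_mul, map_apply,
        submatrix_apply, id]
      refine Fintype.sum_of_injective Subtype.val Subtype.val_injective _ _ (fun i hi => ?_)
        fun i => mul_comm _ _
      have : z i = 0 := by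
        by_contra h
        exact hi ⟨⟨i, h⟩, rfl⟩
      simp [this]
    have hone := one_le_mul_det_gram C' hzli hsol (i := ⟨none, h0.ne'⟩) h0
    let a : Option A → ℝ := fun i => if i = none then (A.card : ℝ) else 1
    have ha : ∀ i, 0 ≤ a i := fun i => by simp only [a]; split_ifs <;> positivity
    have hh : ∀ v k, |(h v k : ℝ)| ≤ 1 := fun v k => by
      cases k with
      | none => simp [h]
      | some k => rw [hcast, abs_of_nonneg (cubePoint_nonneg v k)]; exact cubePoint_le_one v k
    have hC : ∀ k i, |(C k i : ℝ)| ≤ a i := fun k i => by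
      cases i with
      | none =>
        simp only [C, a, Option.elim_none, Int.cast_neg, Int.cast_sum, abs_neg, if_true]
        refine (abs_sum_le_sum_abs _ _).trans ((sum_le_sum fun v _ => hh v k).trans_eq ?_)
        simp
      | some v => simpa [C, a] using hh v k
    have hG : ∀ i j, |((C'ᵀ * C').map (Int.cast : ℤ → ℝ)) i j| ≤
        (n + 1 : ℝ) * (a i * a j) := fun i j => by
      simp only [map_apply, Matrix.mul_apply, transpose_apply, C', submatrix_apply, id,
        Int.cast_sum, Int.cast_mul]
      refine (abs_sum_le_sum_abs _ _).trans ((sum_le_sum fun k _ =>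
        (abs_mul _ _).trans_le (mul_le_mul (hC k i) (hC k j) (abs_nonneg _) (ha i))).trans_eq ?_)
      simp
    have hdet := abs_det_le_of_scaled_entries _ (fun i : {i // z i ≠ 0} => a i) hG
    rw [← Int.cast_det] at hdet
    have hprod : ∏ i : {i // z i ≠ 0}, a i = A.card := by
      rw [Fintype.prod_eq_single (⟨none, h0.ne'⟩ : {i // z i ≠ 0})]
      · simp [a]
      · rintro ⟨i, hi⟩ hne
        have : i ≠ none := fun h => hne (Subtype.ext h)
        simp [a, this]
    have hcard : Fintype.card {i // z i ≠ 0} ≤ n + 1 := by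
      simpa using hzli.fintype_card_le_finrank
    rw [hprod] at hdet
    have hbound : |((C'ᵀ * C').det : ℝ)| ≤
        (n + 1).factorial * ((n + 1) ^ (n + 1) * (A.card : ℝ) ^ 2) := by
      refine hdet.trans ?_
      have h1 : (1 : ℝ) ≤ n + 1 := by linarith [Nat.cast_nonneg (α := ℝ) n]
      gcongr
    have := mul_le_mul hzδ hbound (abs_nonneg _) hδ
    exact hsmall.not_ge (hone.trans this)

end Gap

section Encoding

open Module

variable {n R m : ℕ}

/-- Matrices attached to the vertices in `A`, summing to the identity and certifying membership in
the hull of `A`, together with a spanner `e` through which `A` can be recovered. -/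
structure IsEncoding (A : Finset (Fin n → Bool)) (W : (Fin n → Bool) → Matrix (Fin R) (Fin R) ℝ)
    (e : Fin m → Fin n → Bool) : Prop where
  posSemidef : ∀ v ∈ A, (W v).PosSemidef
  sum_eq_one : ∑ v ∈ A, W v = 1
  mem_hull : ∀ c : (Fin n → Bool) → ℝ, ∑ v ∈ A, c v = 1 → (∑ v ∈ A, c v • W v).PosSemidef →
    ∑ v ∈ A, c v • cubePoint v ∈ convexHull ℝ (cubePoint '' (A : Set (Fin n → Bool)))
  mem : ∀ i, e i ∈ A
  span : ∀ v ∈ A, ∃ c : Fin m → ℝ, (∀ i, |c i| ≤ 1) ∧ ∑ i, c i = 1 ∧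
    ∑ i, c i • cubePoint (e i) = cubePoint v ∧ ∑ i, c i • W (e i) = W v

lemma exists_isEncoding {A : Finset (Fin n → Bool)} (hA : A.Nonempty) {r : ℕ} (hrR : r ≤ R)
    (hEF : HasSdpEF (convexHull ℝ (cubePoint '' (A : Set (Fin n → Bool)))) r)
    (hm : 1 + n + R * R ≤ m) :
    ∃ (W : (Fin n → Bool) → Matrix (Fin R) (Fin R) ℝ) (e : Fin m → Fin n → Bool),
      IsEncoding A W e := by
  obtain ⟨Y, hY, hYhull⟩ := exists_matrix_family_of_hasSdpEF hrR hEF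
  obtain ⟨W, hW, hW1, hWY⟩ := exists_sum_eq_one hA hY
  have hfin : finrank ℝ (ℝ × (Fin n → ℝ) × Matrix (Fin R) (Fin R) ℝ) ≤ m := by
    simp only [finrank_prod, finrank_self, finrank_pi, finrank_matrix, Fintype.card_fin]
    lia
  obtain ⟨e, he, hspan⟩ := exists_barycentric_spanner hA
    (fun v => ((1 : ℝ), cubePoint v, W v)) hfin
  refine ⟨W, e, hW, hW1, fun c hc hpsd => hYhull c hc (hWY c hpsd), he, fun v hv => ?_⟩
  obtain ⟨c, hc, hcv⟩ := hspan v hv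
  simp only [Prod.ext_iff, Prod.fst_sum, Prod.snd_sum, Prod.smul_fst, Prod.smul_snd, smul_eq_mul,
    mul_one] at hcv
  exact ⟨c, hc, hcv.1.symm, hcv.2.1.symm, hcv.2.2.symm⟩

namespace IsEncoding

variable {A A' : Finset (Fin n → Bool)} {W W' : (Fin n → Bool) → Matrix (Fin R) (Fin R) ℝ}
  {e : Fin m → Fin n → Bool}

lemma abs_apply_le_one (h : IsEncoding A W e) {v : Fin n → Bool} (hv : v ∈ A) (i j : Fin R) :
    |W v i j| ≤ 1 := by
  have hdiag : ∀ i, 0 ≤ W v i i ∧ W v i i ≤ 1 := fun i => by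
    refine ⟨(h.posSemidef v hv).diag_nonneg, ?_⟩
    have h1 : ∑ u ∈ A, W u i i = 1 := by
      rw [← Matrix.sum_apply, h.sum_eq_one, one_apply_eq]
    rw [← h1]
    exact single_le_sum (f := fun u => W u i i)
      (fun u hu => (h.posSemidef u hu).diag_nonneg) hv
  rw [← sq_le_one_iff_abs_le_one]
  exact (sq_apply_le_of_posSemidef (h.posSemidef v hv) i j).trans
    (mul_le_one₀ (hdiag i).2 (hdiag j).1 (hdiag j).2)

/-- Two encodings with the same spanner and nearly equal matrices encode the same set. -/
lemma subset (h : IsEncoding A W e) (h' : IsEncoding A' W' e) {ε : ℝ} (hε : 0 ≤ ε)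
    (hclose : ∀ i j k, |W' (e i) j k - W (e i) j k| ≤ ε)
    (hsmall : m * ε * R * ((n + 1).factorial * ((n + 1) ^ (n + 1) * (2 ^ n) ^ 2)) < 1) :
    A ⊆ A' := by
  intro x hx
  obtain ⟨c, hc, hc1, hcx, hcW⟩ := h.span x hx
  set δ : ℝ := m * ε * R with hδ
  have hδ0 : 0 ≤ δ := by positivity
  let c' : (Fin n → Bool) → ℝ := fun v => ∑ i, if e i = v then c i else 0
  have hpush : ∀ {V : Type} [AddCommGroup V] [Module ℝ V] (f : (Fin n → Bool) → V),
      ∑ v ∈ A', c' v • f v = ∑ i, c i • f (e i) := fun f => by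
    simp only [c', sum_smul, ite_smul, zero_smul]
    rw [sum_comm]
    refine sum_congr rfl fun i _ => ?_
    rw [sum_ite_eq, if_pos (h'.mem i)]
  have hpush1 : ∑ v ∈ A', c' v = 1 := by simpa [hc1] using hpush fun _ => (1 : ℝ)
  have hAcard : (A'.card : ℝ) ≤ 2 ^ n := by
    have := card_le_univ A'
    simp only [Fintype.card_pi, Fintype.card_bool, prod_const, card_univ, Fintype.card_fin] at this
    exact_mod_cast this
  set s : ℝ := 1 + δ * A'.card with hs
  have hs0 : 0 < s := by positivity
  have hpsd : (∑ v ∈ A', (c' v + δ) • W' v).PosSemidef := by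
    set E := ∑ i, c i • (W' (e i) - W (e i)) with hE
    have hEh : E.IsHermitian := by
      refine IsHermitian.ext fun j k => ?_
      simp only [hE, Matrix.sum_apply, Matrix.smul_apply, Matrix.sub_apply, star_trivial]
      refine sum_congr rfl fun i _ => ?_
      have h1 := (h'.posSemidef _ (h'.mem i)).isHermitian.apply j k
      have h2 := (h.posSemidef _ (h.mem i)).isHermitian.apply j k
      rw [star_trivial] at h1 h2
      rw [h1, h2]
    have hEle : ∀ j k, |E j k| ≤ m * ε := fun j k => by
      simp only [hE, Matrix.sum_apply, Matrix.smul_apply, Matrix.sub_apply, smul_eq_mul]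
      refine (abs_sum_le_sum_abs _ _).trans ((sum_le_sum fun i _ => (abs_mul _ _).trans_le
        (mul_le_mul (hc i) (hclose i j k) (abs_nonneg _) zero_le_one)).trans_eq ?_)
      simp
    have hsplit : ∑ v ∈ A', (c' v + δ) • W' v = W x + (E + (m * ε * R) • 1) := by
      simp only [add_smul, sum_add_distrib, ← smul_sum, h'.sum_eq_one, hpush W', hE, smul_sub,
        sum_sub_distrib, hcW, ← hδ]
      abel
    rw [hsplit]
    exact (h.posSemidef x hx).add (by simpa using posSemidef_add_smul_one hEh hEle)
  have hsum : ∑ v ∈ A', (c' v + δ) = s := by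
    rw [sum_add_distrib, hpush1, sum_const, nsmul_eq_mul, mul_comm]
  have hscale : ∀ {V : Type} [AddCommGroup V] [Module ℝ V] (f : (Fin n → Bool) → V),
      ∑ v ∈ A', (s⁻¹ * (c' v + δ)) • f v = s⁻¹ • ∑ v ∈ A', (c' v + δ) • f v := fun f => by
    simp only [mul_smul, smul_sum]
  have hhull := h'.mem_hull (fun v => s⁻¹ * (c' v + δ))
    (by rw [← mul_sum, hsum, inv_mul_cancel₀ hs0.ne'])
    (by rw [hscale]; exact hpsd.smul (inv_nonneg.mpr hs0.le))
  rw [hscale, mem_convexHull_cubePoint_iff] at hhull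
  obtain ⟨w, hw, hw1, hwx⟩ := hhull
  refine mem_of_add_smul_sum_mem_cone hδ0 (w := fun v => s * w v)
    (fun v hv => mul_nonneg hs0.le (hw v hv)) (by rw [← mul_sum, hw1, mul_one]) ?_
    (lt_of_le_of_lt (by gcongr) hsmall)
  simp only [mul_smul, ← smul_sum]
  rw [hwx, smul_inv_smul₀ hs0.ne']
  simp only [add_smul, sum_add_distrib, ← smul_sum, hpush, hcx]

end IsEncoding

lemma card_nonempty_finset_cube :
    Fintype.card {A : Finset (Fin n → Bool) // A.Nonempty} = 2 ^ 2 ^ n - 1 := by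
  have : (univ.filter fun A : Finset (Fin n → Bool) => A.Nonempty) = univ.erase ∅ := by
    ext A; simp [nonempty_iff_ne_empty]
  rw [Fintype.card_subtype, this, card_erase_of_mem (mem_univ _)]
  simp

/-- If all 0/1 polytopes have formulations of size at most `R`, then counting the encodings rounded
to precision `1 / q` bounds the number of 0/1 polytopes. -/
lemma two_pow_sub_one_le_of_forall_hasSdpEF (q : ℕ)
    (hq : (1 + n + R * R) * R * ((n + 1).factorial * ((n + 1) ^ (n + 1) * (2 ^ n) ^ 2)) < q)
    (hEF : ∀ A : Finset (Fin n → Bool), A.Nonempty →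
      ∃ r ≤ R, HasSdpEF (convexHull ℝ (cubePoint '' (A : Set (Fin n → Bool)))) r) :
    2 ^ 2 ^ n - 1 ≤ (2 ^ n * (2 * q + 1) ^ (R * R)) ^ (1 + n + R * R) := by
  have hq0 : (0 : ℝ) < q := by exact_mod_cast (Nat.zero_le _).trans_lt hq
  set m := 1 + n + R * R with hm
  have henc : ∀ A : {A : Finset (Fin n → Bool) // A.Nonempty},
      ∃ (W : (Fin n → Bool) → Matrix (Fin R) (Fin R) ℝ) (e : Fin m → Fin n → Bool),
        IsEncoding A.1 W e := fun A => by
    obtain ⟨r, hr, h⟩ := hEF A A.2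
    exact exists_isEncoding A.2 hr h hm.ge
  choose W e hWe using henc
  have hround : ∀ A i j k, ⌊(W A (e A i) j k + 1) * q⌋₊ < 2 * q + 1 := fun A i j k => by
    have h := abs_le.mp ((hWe A).abs_apply_le_one ((hWe A).mem i) j k)
    rw [Nat.lt_succ_iff]
    refine Nat.floor_le_of_le ?_
    push_cast
    gcongr
    linarith
  let code : {A : Finset (Fin n → Bool) // A.Nonempty} →
      Fin m → (Fin n → Bool) × (Fin R × Fin R → Fin (2 * q + 1)) :=
    fun A i => (e A i, fun p => ⟨_, hround A i p.1 p.2⟩)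
  have hsubset : ∀ A A', code A = code A' → A.1 ⊆ A'.1 := fun A A' hAA' => by
    have he : e A = e A' := by
      ext1 i; exact congrArg Prod.fst (congrFun hAA' i)
    have hA' := hWe A'
    rw [← he] at hA'
    refine (hWe A).subset hA' (ε := 1 / q) (by positivity) (fun i j k => ?_) ?_
    · have hfloor : ⌊(W A' (e A i) j k + 1) * q⌋₊ = ⌊(W A (e A i) j k + 1) * q⌋₊ := by
        have h := congrArg Fin.val (congrFun (congrArg Prod.snd (congrFun hAA' i)) (j, k))
        simp only [code] at h
        rw [h, he]
      have hnonneg : ∀ {B : Finset (Fin n → Bool)} {V}, IsEncoding B V (e A) →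
          0 ≤ (V (e A i) j k + 1) * q := fun hB => by
        have h := (abs_le.mp (hB.abs_apply_le_one (hB.mem i) j k)).1
        exact mul_nonneg (by linarith) hq0.le
      have h1 := Nat.floor_le (hnonneg hA')
      have h2 := Nat.floor_le (hnonneg (hWe A))
      have h3 := Nat.lt_floor_add_one ((W A' (e A i) j k + 1) * q)
      have h4 := Nat.lt_floor_add_one ((W A (e A i) j k + 1) * q)
      rw [hfloor] at h1 h3
      rw [le_div_iff₀ hq0, ← abs_of_pos hq0, ← abs_mul, abs_le]
      constructor <;> nlinarith
    · have hqR : ((m * R * ((n + 1).factorial * ((n + 1) ^ (n + 1) * (2 ^ n) ^ 2)) : ℕ) : ℝ) < q :=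
        by exact_mod_cast hq
      push_cast at hqR
      calc _ = (m * R * ((n + 1).factorial * ((n + 1) ^ (n + 1) * (2 ^ n) ^ 2)) : ℝ) / q := by
            ring
        _ < 1 := (div_lt_one hq0).mpr (by exact_mod_cast hqR)
  have hinj : Function.Injective code := fun A A' h =>
    Subtype.ext ((hsubset A A' h).antisymm (hsubset A' A h.symm))
  have := Fintype.card_le_of_injective code hinj
  rw [card_nonempty_finset_cube] at this
  simpa using this

end Encoding

section Numerics

lemma logb_precision_le {n R : ℕ} (hn : 10 ≤ n) (hlog : 40 ≤ Real.logb 2 n) (hR : R ^ 4 ≤ 2 ^ n) :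
    Real.logb 2 (2 * ((1 + n + R * R) * R *
      ((n + 1).factorial * ((n + 1) ^ (n + 1) * (2 ^ n) ^ 2)) + 1) + 1 : ℕ) ≤
        5 / 2 * (n * Real.logb 2 n) := by
  have hn2 : n + 1 ≤ 2 ^ n := Nat.lt_two_pow_self
  have hRR : R * R ≤ 2 ^ n := by
    rcases Nat.eq_zero_or_pos R with rfl | h
    · simp
    · exact le_trans (by nlinarith [Nat.mul_le_mul h h]) hR
  have hR1 : R ≤ 2 ^ n := le_trans (by nlinarith) hRR
  have hfact : (n + 1).factorial ≤ (n + 1) ^ (n + 1) := Nat.factorial_le_pow _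
  have hmain : (1 + n + R * R) * R * ((n + 1).factorial * ((n + 1) ^ (n + 1) * (2 ^ n) ^ 2)) ≤
      2 ^ (4 * n + 1) * (n + 1) ^ (2 * n + 2) := by
    calc _ ≤ (2 ^ n + 2 ^ n) * 2 ^ n * ((n + 1) ^ (n + 1) * ((n + 1) ^ (n + 1) * (2 ^ n) ^ 2)) := by
          gcongr; lia
      _ = _ := by ring
  have hq : 2 * ((1 + n + R * R) * R *
      ((n + 1).factorial * ((n + 1) ^ (n + 1) * (2 ^ n) ^ 2)) + 1) + 1 ≤
        2 ^ (4 * n + 4) * (n + 1) ^ (2 * n + 2) := by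
    have h1 : 1 ≤ 2 ^ (4 * n + 1) * (n + 1) ^ (2 * n + 2) := Nat.one_le_iff_ne_zero.mpr (by positivity)
    have h2 : 2 ^ (4 * n + 4) * (n + 1) ^ (2 * n + 2) =
        8 * (2 ^ (4 * n + 1) * (n + 1) ^ (2 * n + 2)) := by ring
    lia
  have hnR : (10 : ℝ) ≤ n := by exact_mod_cast hn
  have hsucc : Real.logb 2 (n + 1) ≤ Real.logb 2 n + 1 := by
    have : Real.logb 2 (n * 2) = Real.logb 2 n + 1 := by
      rw [Real.logb_mul (by linarith) two_ne_zero, Real.logb_self_eq_one one_lt_two]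
    rw [← this]
    exact Real.logb_le_logb_of_le one_lt_two (by linarith) (by linarith)
  calc _ ≤ Real.logb 2 ((2 : ℝ) ^ (4 * n + 4) * ((n : ℝ) + 1) ^ (2 * n + 2)) :=
        Real.logb_le_logb_of_le one_lt_two (by positivity) (by exact_mod_cast hq)
    _ = (4 * n + 4) + (2 * n + 2) * Real.logb 2 (n + 1) := by
        rw [Real.logb_mul (by positivity) (by positivity), Real.logb_pow, Real.logb_pow,
          Real.logb_self_eq_one one_lt_two]
        push_cast; ring
    _ ≤ _ := by nlinarith

lemma encoding_count_lt {n R : ℕ} (hn : 10 ≤ n) (hlog : 40 ≤ Real.logb 2 n)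
    (hpow : 5184 * (n : ℝ) ^ 6 ≤ 2 ^ n) (hR : (R : ℝ) ^ 4 * (3 * n * Real.logb 2 n) ≤ 2 ^ n) :
    (2 ^ n * (2 * ((1 + n + R * R) * R *
      ((n + 1).factorial * ((n + 1) ^ (n + 1) * (2 ^ n) ^ 2)) + 1) + 1) ^ (R * R)) ^
        (1 + n + R * R) < 2 ^ 2 ^ n - 1 := by
  set q := 2 * ((1 + n + R * R) * R *
      ((n + 1).factorial * ((n + 1) ^ (n + 1) * (2 ^ n) ^ 2)) + 1) + 1 with hq
  have hnR : (10 : ℝ) ≤ n := by exact_mod_cast hn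
  set l := Real.logb 2 n with hl
  have hln : l ≤ n := by
    rw [hl, Real.logb_le_iff_le_rpow one_lt_two (by linarith), Real.rpow_natCast]
    exact_mod_cast Nat.lt_two_pow_self.le
  have hR4 : (R : ℝ) ^ 4 ≤ 2 ^ n := by
    refine le_trans (le_mul_of_one_le_right (by positivity) ?_) hR
    nlinarith
  have hqlog : Real.logb 2 (q : ℕ) ≤ 5 / 2 * (n * l) :=
    logb_precision_le hn hlog (by exact_mod_cast hR4)
  set u : ℝ := R * R with hu
  have hu0 : 0 ≤ u := by positivity
  have hu2 : u * u = (R : ℝ) ^ 4 := by rw [hu]; ring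
  have hu_lin : 72 * (n : ℝ) ^ 3 * u ≤ 2 ^ n := by
    refine (le_abs_self _).trans (abs_le_of_sq_le_sq ?_ (by positivity))
    calc (72 * (n : ℝ) ^ 3 * u) ^ 2 = 5184 * (n : ℝ) ^ 6 * (R : ℝ) ^ 4 := by rw [← hu2]; ring
      _ ≤ 2 ^ n * 2 ^ n := by gcongr
      _ = _ := by ring
  have hbits : (1 + n + u) * (n + u * Real.logb 2 (q : ℕ)) ≤ 2 ^ n - 1 := by
    have h1 : (1 + n + u) * (n + u * Real.logb 2 (q : ℕ)) ≤
        (1 + n + u) * (n + u * (5 / 2 * (n * l))) := by gcongr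
    have h2 : u * u * (5 / 2 * (n * l)) ≤ 5 / 6 * 2 ^ n := by rw [hu2]; linarith
    have h3 : n + (1 + n) * (5 / 2 * (n * l)) ≤ 6 * (n : ℝ) ^ 3 := by
      have : (n : ℝ) * l ≤ n * n := by gcongr
      nlinarith [mul_nonneg (by linarith : (0 : ℝ) ≤ n) (by linarith : (0 : ℝ) ≤ n - 10),
        mul_nonneg (by positivity : (0 : ℝ) ≤ n * n) (by linarith : (0 : ℝ) ≤ n - 10)]
    have h4 : u * (n + (1 + n) * (5 / 2 * (n * l))) ≤ 1 / 12 * 2 ^ n :=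
      (mul_le_mul_of_nonneg_left h3 hu0).trans (by linarith)
    have h5 : (n : ℝ) * (1 + n) + 1 ≤ 1 / 12 * 2 ^ n := by
      have h6 : (n : ℝ) ^ 2 * 1 ≤ n ^ 2 * n ^ 4 := by
        gcongr
        exact one_le_pow₀ (by linarith)
      nlinarith
    nlinarith
  have hone : 1 ≤ 2 ^ n := Nat.one_le_two_pow
  have hle : (2 ^ n * q ^ (R * R)) ^ (1 + n + R * R) ≤ 2 ^ (2 ^ n - 1) := by
    have hq0 : (0 : ℝ) < q := by rw [hq]; positivity
    have hreal : ((2 : ℝ) ^ n * (q : ℝ) ^ (R * R)) ^ (1 + n + R * R) ≤ 2 ^ (2 ^ n - 1) := by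
      rw [← Real.logb_le_logb one_lt_two (by positivity) (by positivity), Real.logb_pow,
        Real.logb_mul (by positivity) (by positivity), Real.logb_pow, Real.logb_pow, Real.logb_pow,
        Real.logb_self_eq_one one_lt_two]
      push_cast [hone]
      linarith
    exact_mod_cast hreal
  have hexp : 2 ^ 2 ^ n = 2 * 2 ^ (2 ^ n - 1) := by
    rw [← pow_succ', Nat.sub_add_cancel hone]
  have h2 : 2 ≤ 2 ^ (2 ^ n - 1) := by
    refine Nat.le_self_pow ?_ 2
    have : 2 ^ 1 ≤ 2 ^ n := Nat.pow_le_pow_right two_pos (by lia)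
    lia
  lia

lemma eventually_growth_conditions :
    ∃ n₀ : ℕ, ∀ n : ℕ, n₀ ≤ n →
      10 ≤ n ∧ 40 ≤ Real.logb 2 n ∧ 5184 * (n : ℝ) ^ 6 ≤ 2 ^ n := by
  have hlog : ∀ᶠ n : ℕ in Filter.atTop, 40 ≤ Real.logb 2 n :=
    ((Real.tendsto_logb_atTop one_lt_two).comp tendsto_natCast_atTop_atTop).eventually_ge_atTop 40
  have hpow : ∀ᶠ n : ℕ in Filter.atTop, 5184 * (n : ℝ) ^ 6 ≤ 2 ^ n := by
    have h := tendsto_pow_const_div_const_pow_of_one_lt 6 (one_lt_two (α := ℝ))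
    filter_upwards [h.eventually_lt_const (by norm_num : (0 : ℝ) < 1 / 5184)] with n hn
    rw [div_lt_iff₀ (by positivity)] at hn
    linarith
  exact Filter.eventually_atTop.mp ((Filter.eventually_ge_atTop 10).and (hlog.and hpow))

end Numerics

section Bounds

variable {n : ℕ}

lemma hasSdpEF_xcs_convexHull_cubePoint (A : Finset (Fin n → Bool)) :
    HasSdpEF (convexHull ℝ (cubePoint '' (A : Set (Fin n → Bool))))
      (xcs (convexHull ℝ (cubePoint '' (A : Set (Fin n → Bool))))) :=
  Nat.sInf_mem (s := {r | HasSdpEF (convexHull ℝ (cubePoint '' (A : Set (Fin n → Bool)))) r})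
    ⟨_, hasSdpEF_convexHull_cubePoint A⟩

lemma cubePoint_mem_zero_one (A : Finset (Fin n → Bool)) :
    ∀ x ∈ cubePoint '' (A : Set (Fin n → Bool)), ∀ k, x k = 0 ∨ x k = 1 := by
  rintro _ ⟨v, -, rfl⟩ k
  unfold cubePoint
  split_ifs <;> simp

lemma exists_le_xcs_of_growth (hn : 10 ≤ n) (hlog : 40 ≤ Real.logb 2 n)
    (hpow : 5184 * (n : ℝ) ^ 6 ≤ 2 ^ n) :
    ∃ A : Finset (Fin n → Bool), A.Nonempty ∧
      (2 : ℝ) ^ ((n : ℝ) / 4) / (3 * (n : ℝ) * Real.logb 2 n) ^ ((1 : ℝ) / 4) ≤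
        (xcs (convexHull ℝ (cubePoint '' (A : Set (Fin n → Bool)))) : ℝ) := by
  by_contra! hlt
  set B : ℝ := (2 : ℝ) ^ ((n : ℝ) / 4) / (3 * (n : ℝ) * Real.logb 2 n) ^ ((1 : ℝ) / 4) with hB
  have hden : 0 < 3 * (n : ℝ) * Real.logb 2 n := by
    have : (0 : ℝ) < n := by exact_mod_cast (by lia : 0 < n)
    have : 0 < Real.logb 2 n := by linarith
    positivity
  have hB0 : 0 ≤ B := by positivity
  have hB4 : B ^ 4 * (3 * n * Real.logb 2 n) = 2 ^ n := by
    have h1 : ((2 : ℝ) ^ ((n : ℝ) / 4)) ^ 4 = 2 ^ n := by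
      rw [← Real.rpow_natCast, ← Real.rpow_mul two_pos.le, ← Real.rpow_natCast 2 n]
      congr 1
      push_cast
      ring
    have h2 : ((3 * (n : ℝ) * Real.logb 2 n) ^ ((1 : ℝ) / 4)) ^ 4 =
        3 * (n : ℝ) * Real.logb 2 n := by
      rw [← Real.rpow_natCast, ← Real.rpow_mul hden.le]
      norm_num
    rw [hB, div_pow, h1, h2, div_mul_cancel₀ _ hden.ne']
  set R := ⌊B⌋₊ with hR
  have hR4 : (R : ℝ) ^ 4 * (3 * n * Real.logb 2 n) ≤ 2 ^ n := by
    rw [← hB4]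
    gcongr
    exact Nat.floor_le hB0
  exact (two_pow_sub_one_le_of_forall_hasSdpEF _ (Nat.lt_succ_self _) fun A hA =>
    ⟨_, Nat.le_floor (hlt A hA).le, hasSdpEF_xcs_convexHull_cubePoint A⟩).not_gt
      (encoding_count_lt hn hlog hpow hR4)

lemma exists_one_le_xcs (hn : 0 < n) :
    ∃ A : Finset (Fin n → Bool), A.Nonempty ∧
      1 ≤ xcs (convexHull ℝ (cubePoint '' (A : Set (Fin n → Bool)))) := by
  refine ⟨{fun _ => false, fun _ => true}, by simp, ?_⟩
  set A : Finset (Fin n → Bool) := {fun _ => false, fun _ => true} with hA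
  by_contra! hlt
  obtain ⟨m, a, U, b, -, hK⟩ :=
    Nat.lt_one_iff.mp hlt ▸ hasSdpEF_xcs_convexHull_cubePoint A
  have hmem : ∀ v ∈ A, ∀ i, a i ⬝ᵥ cubePoint v = b i := fun v hv i => by
    have h : cubePoint v ∈ convexHull ℝ (cubePoint '' (A : Set (Fin n → Bool))) :=
      subset_convexHull ℝ _ ⟨v, hv, rfl⟩
    rw [hK] at h
    obtain ⟨Y, -, hY⟩ := h
    simpa [Matrix.trace] using hY i
  have h0 : cubePoint (fun _ : Fin n => false) = 0 := by ext; simp [cubePoint]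
  have hout : (2 : ℝ) • cubePoint (fun _ : Fin n => true) ∈
      convexHull ℝ (cubePoint '' (A : Set (Fin n → Bool))) := by
    rw [hK]
    refine ⟨0, PosSemidef.zero, fun i => ?_⟩
    have h1 := hmem (fun _ => false) (by simp [hA]) i
    rw [h0, dotProduct_zero] at h1
    rw [dotProduct_smul, hmem (fun _ => true) (by simp [hA]) i, ← h1]
    simp
  obtain ⟨w, hw, hw1, hwx⟩ := mem_convexHull_cubePoint_iff.mp hout
  have h2 : ∑ v ∈ A, w v * cubePoint v ⟨0, hn⟩ = 2 := by
    simpa [Finset.sum_apply, cubePoint] using congrFun hwx ⟨0, hn⟩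
  have h3 : ∑ v ∈ A, w v * cubePoint v ⟨0, hn⟩ ≤ ∑ v ∈ A, w v :=
    sum_le_sum fun v hv => mul_le_of_le_one_right (hw v hv) (cubePoint_le_one v _)
  linarith

end Bounds

end SdpCounting

/-- Theorem 4.2: for all sufficiently large `n` there is a set
`𝒳 ⊆ {0,1}ⁿ` with `xcs(conv 𝒳) ≥ 2^{n/4}/(3 n log₂ n)^{1/4}`; in particular
there is a constant `c > 0` such that for every `n` some 0/1 polytope in `ℝⁿ`
has semidefinite extension complexity at least `c · 2^{n/4}/(n log₂ n)^{1/4}`. -/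
theorem exists_01_polytope_high_sdp_xc :
    (∃ n₀ : ℕ, ∀ n : ℕ, n₀ ≤ n →
      ∃ 𝒳 : Set (Fin n → ℝ), 𝒳.Nonempty ∧ (∀ x ∈ 𝒳, ∀ k, x k = 0 ∨ x k = 1) ∧
        (2 : ℝ) ^ ((n : ℝ) / 4) / (3 * (n : ℝ) * Real.logb 2 n) ^ ((1 : ℝ) / 4) ≤
          (xcs (convexHull ℝ 𝒳) : ℝ)) ∧
    (∃ c : ℝ, 0 < c ∧ ∀ n : ℕ,
      ∃ 𝒳 : Set (Fin n → ℝ), 𝒳.Nonempty ∧ (∀ x ∈ 𝒳, ∀ k, x k = 0 ∨ x k = 1) ∧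
        c * (2 : ℝ) ^ ((n : ℝ) / 4) / ((n : ℝ) * Real.logb 2 n) ^ ((1 : ℝ) / 4) ≤
          (xcs (convexHull ℝ 𝒳) : ℝ)) := by
  obtain ⟨n₀, hn₀⟩ := SdpCounting.eventually_growth_conditions
  have hlarge : ∀ n : ℕ, n₀ ≤ n →
      ∃ 𝒳 : Set (Fin n → ℝ), 𝒳.Nonempty ∧ (∀ x ∈ 𝒳, ∀ k, x k = 0 ∨ x k = 1) ∧
        (2 : ℝ) ^ ((n : ℝ) / 4) / (3 * (n : ℝ) * Real.logb 2 n) ^ ((1 : ℝ) / 4) ≤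
          (xcs (convexHull ℝ 𝒳) : ℝ) := fun n hn => by
    obtain ⟨h10, hlog, hpow⟩ := hn₀ n hn
    obtain ⟨A, hA, hle⟩ := SdpCounting.exists_le_xcs_of_growth h10 hlog hpow
    exact ⟨_, hA.to_set.image _, SdpCounting.cubePoint_mem_zero_one A, hle⟩
  refine ⟨⟨n₀, hlarge⟩, 1 / (3 * 2 ^ n₀), by positivity, fun n => ?_⟩
  rcases lt_or_ge n 2 with hn2 | hn2
  · have hzero : (n : ℝ) * Real.logb 2 n = 0 := by interval_cases n <;> simp
    refine ⟨{0}, Set.singleton_nonempty 0, fun x hx k => Or.inl (by rw [hx]; rfl), ?_⟩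
    rw [hzero, Real.zero_rpow (by norm_num), div_zero]
    positivity
  have hnR : (2 : ℝ) ≤ n := by exact_mod_cast hn2
  have hlog : 1 ≤ Real.logb 2 n := by
    rw [Real.le_logb_iff_rpow_le one_lt_two (by linarith), Real.rpow_one]
    exact hnR
  set t := (n : ℝ) * Real.logb 2 n with ht
  have ht1 : 1 ≤ t := by nlinarith
  have ht1' : 1 ≤ t ^ ((1 : ℝ) / 4) := Real.one_le_rpow ht1 (by norm_num)
  have hn₀1 : (1 : ℝ) ≤ 2 ^ n₀ := one_le_pow₀ one_le_two
  rcases lt_or_ge n n₀ with hn | hn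
  · obtain ⟨A, hA, hle⟩ := SdpCounting.exists_one_le_xcs (by lia : 0 < n)
    refine ⟨_, hA.to_set.image _, SdpCounting.cubePoint_mem_zero_one A, le_trans ?_
      (Nat.one_le_cast.mpr hle)⟩
    have hpow : (2 : ℝ) ^ ((n : ℝ) / 4) ≤ 2 ^ n₀ := by
      rw [← Real.rpow_natCast]
      refine Real.rpow_le_rpow_of_exponent_le one_le_two ?_
      have : (n : ℝ) ≤ n₀ := by exact_mod_cast hn.le
      linarith
    refine (div_le_self (by positivity) ht1').trans ?_
    rw [one_div, inv_mul_le_iff₀ (by positivity)]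
    linarith
  · obtain ⟨𝒳, h𝒳, h01, hle⟩ := hlarge n hn
    refine ⟨𝒳, h𝒳, h01, le_trans ?_ hle⟩
    rw [mul_assoc 3 (n : ℝ), ← ht, Real.mul_rpow (x := 3) (y := t) (by norm_num) (by linarith)]
    have h3 : (3 : ℝ) ^ ((1 : ℝ) / 4) ≤ 3 := by
      simpa using Real.rpow_le_rpow_of_exponent_le (by norm_num : (1 : ℝ) ≤ 3)
        (by norm_num : (1 : ℝ) / 4 ≤ 1)
    have h3' : (3 : ℝ) ^ ((1 : ℝ) / 4) ≤ 3 * 2 ^ n₀ := by linarith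
    calc 1 / (3 * 2 ^ n₀) * (2 : ℝ) ^ ((n : ℝ) / 4) / t ^ ((1 : ℝ) / 4)
        = (2 : ℝ) ^ ((n : ℝ) / 4) / (3 * 2 ^ n₀ * t ^ ((1 : ℝ) / 4)) := by field_simp
      _ ≤ _ := by gcongr
end
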